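/- arXiv:2006.08704 — 2 statements merged into one kernel-verified Lean document; each statement's English description precedes it below -/
import Mathlib

section
/- Let A be a group admitting a bi-invariant circular ordering, and let G be a circularly-orderable group such that every minimal element of Ob(G) under divisibility is a prime number. Then G × A is circularly-orderable if and only if min(Ob(G)) ∩ min(Ob(A)) = ∅, where min denotes the set of minimal elements under divisibility. -/
/-- A (left-invariant, homogeneous) circular ordering on a group `G`. -/
def IsHomCircularOrdering {G : Type*} [Group G] (c : G → G → G → ℤ) : Prop :=
  (∀ g₁ g₂ g₃ : G, c g₁ g₂ g₃ = 0 ∨ c g₁ g₂ g₃ = 1 ∨ c g₁ g₂ g₃ = -1) ∧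
  (∀ g₁ g₂ g₃ : G, c g₁ g₂ g₃ = 0 ↔ (g₁ = g₂ ∨ g₁ = g₃ ∨ g₂ = g₃)) ∧
  (∀ g₁ g₂ g₃ g₄ : G, c g₂ g₃ g₄ - c g₁ g₃ g₄ + c g₁ g₂ g₄ - c g₁ g₂ g₃ = 0) ∧
  (∀ h g₁ g₂ g₃ : G, c (h * g₁) (h * g₂) (h * g₃) = c g₁ g₂ g₃)

/-- A bi-invariant circular ordering: a circular ordering also invariant under
right multiplication. -/
def IsBiInvariantCircularOrdering {G : Type*} [Group G] (c : G → G → G → ℤ) : Prop :=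
  IsHomCircularOrdering c ∧ ∀ h g₁ g₂ g₃ : G, c (g₁ * h) (g₂ * h) (g₃ * h) = c g₁ g₂ g₃

/-- A group is circularly-orderable if it admits a (left-invariant) circular ordering. -/
def CircularlyOrderable (G : Type*) [Group G] : Prop :=
  ∃ c : G → G → G → ℤ, IsHomCircularOrdering c

/-- The obstruction spectrum `Ob(G)` of a group `G`. -/
def Ob (G : Type*) [Group G] : Set ℕ :=
  {n : ℕ | 2 ≤ n ∧ ¬ CircularlyOrderable (G × Multiplicative (ZMod n))}

/-- The set of minimal elements of `Ob(G)` under the divisibility order. -/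
def minOb (G : Type*) [Group G] : Set ℕ :=
  {n ∈ Ob G | ∀ m ∈ Ob G, m ∣ n → m = n}

namespace IsHomCircularOrdering

variable {G : Type*} [Group G] {c : G → G → G → ℤ}

theorem swap_left (hc : IsHomCircularOrdering c) (x y z : G) : c y x z = -c x y z := by
  have h := hc.2.2.1 x y x z
  have h1 : c x x z = 0 := (hc.2.1 _ _ _).2 (by simp)
  have h2 : c x y x = 0 := (hc.2.1 _ _ _).2 (by simp)
  omega

theorem swap_right (hc : IsHomCircularOrdering c) (x y z : G) : c x z y = -c x y z := by
  have h := hc.2.2.1 x y z y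
  have h1 : c y z y = 0 := (hc.2.1 _ _ _).2 (by simp)
  have h2 : c x y y = 0 := (hc.2.1 _ _ _).2 (by simp)
  omega

end IsHomCircularOrdering

namespace CircularlyOrderable

/-- Circular orderings pull back along injective homomorphisms. -/
theorem of_injective {G H : Type*} [Group G] [Group H] (f : H →* G)
    (hf : Function.Injective f) (hG : CircularlyOrderable G) : CircularlyOrderable H := by
  obtain ⟨c, h1, h2, h3, h4⟩ := hG
  refine ⟨fun x y z => c (f x) (f y) (f z), fun x y z => h1 _ _ _, fun x y z => ?_,
    fun _ _ _ _ => h3 _ _ _ _, fun h x y z => ?_⟩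
  · simp only [h2, hf.eq_iff]
  · simp only [map_mul, h4]

open Classical in
/-- A group is circularly-orderable if it maps to a circularly-orderable group with kernel
left-ordered by the positive cone `P`. -/
theorem of_cone_ker {B Q : Type*} [Group B] [Group Q] (f : B →* Q) (hQ : CircularlyOrderable Q)
    (P : B → Prop) (hmul : ∀ x y, P x → P y → P (x * y)) (hker : ∀ x, P x → f x = 1)
    (hone : ¬ P 1) (htri : ∀ x, f x = 1 → x = 1 ∨ P x ∨ P x⁻¹) : CircularlyOrderable B := by
  obtain ⟨c, h1, h2, h3, h4⟩ := hQ
  have hdisj : ∀ x, P x → ¬ P x⁻¹ := fun x hx hx' => hone (by simpa using hmul _ _ hx hx')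
  obtain ⟨s, hs⟩ : ∃ s : B → ℤ, s = fun x => if P x then 1 else if P x⁻¹ then -1 else 0 :=
    ⟨_, rfl⟩
  have s_pos : ∀ x, s x = 1 ↔ P x := fun x => by
    rw [hs]; dsimp only; split_ifs <;> simp_all
  have s_inv : ∀ x, s x⁻¹ = -s x := fun x => by
    rw [hs]; dsimp only; rw [inv_inv]
    have := hdisj x
    split_ifs <;> simp_all
  have s_neg : ∀ x, s x = -1 ↔ P x⁻¹ := fun x => by rw [← s_pos, s_inv]; omega
  have s_val : ∀ x, s x = 0 ∨ s x = 1 ∨ s x = -1 := fun x => by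
    rw [hs]; dsimp only; split_ifs <;> simp
  have s_one : s 1 = 0 := by have := s_inv 1; rw [inv_one] at this; omega
  have s_out : ∀ x, f x ≠ 1 → s x = 0 := fun x hx => by
    rcases s_val x with h | h | h
    · exact h
    · exact absurd (hker _ ((s_pos x).1 h)) hx
    · have := hker _ ((s_neg x).1 h)
      rw [map_inv, inv_eq_one] at this
      exact absurd this hx
  have s_zero : ∀ x, f x = 1 → s x = 0 → x = 1 := fun x hx h0 => by
    rcases htri x hx with h | h | h
    · exact h
    · rw [← s_pos] at h; omega
    · rw [← s_neg] at h; omega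
  have s_mul : ∀ x y, s x = 1 → s y = 1 → s (x * y) = 1 := fun x y hx hy => by
    rw [s_pos] at *; exact hmul _ _ hx hy
  have s_mul' : ∀ x y, s x = -1 → s y = -1 → s (x * y) = -1 := fun x y hx hy => by
    rw [s_neg] at *; rw [mul_inv_rev]; exact hmul _ _ hy hx
  have key : ∀ x y z, f x = f y → f y = f z →
      (s (x⁻¹ * y) + s (y⁻¹ * z) - s (x⁻¹ * z) = 0 ∨
        s (x⁻¹ * y) + s (y⁻¹ * z) - s (x⁻¹ * z) = 1 ∨
        s (x⁻¹ * y) + s (y⁻¹ * z) - s (x⁻¹ * z) = -1) ∧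
      (s (x⁻¹ * y) + s (y⁻¹ * z) - s (x⁻¹ * z) = 0 ↔
        s (x⁻¹ * y) = 0 ∨ s (x⁻¹ * z) = 0 ∨ s (y⁻¹ * z) = 0) := fun x y z hxy hyz => by
    have e : x⁻¹ * z = (x⁻¹ * y) * (y⁻¹ * z) := by group
    have ha := s_zero (x⁻¹ * y) (by simp [hxy])
    have hb := s_zero (y⁻¹ * z) (by simp [hyz])
    have hm := s_mul (x⁻¹ * y) (y⁻¹ * z)
    have hm' := s_mul' (x⁻¹ * y) (y⁻¹ * z)
    rw [← e] at hm hm'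
    have ha' : s (x⁻¹ * y) = 0 → s (x⁻¹ * z) = s (y⁻¹ * z) := fun h => by rw [e, ha h, one_mul]
    have hb' : s (y⁻¹ * z) = 0 → s (x⁻¹ * z) = s (x⁻¹ * y) := fun h => by rw [e, hb h, mul_one]
    have := s_val (x⁻¹ * y)
    have := s_val (y⁻¹ * z)
    have := s_val (x⁻¹ * z)
    omega
  have s_eq : ∀ x y, f x = f y → (s (x⁻¹ * y) = 0 ↔ x = y) := fun x y hxy =>
    ⟨fun h => inv_mul_eq_one.1 (s_zero _ (by simp [hxy]) h), fun h => by simp [h, s_one]⟩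
  have s_ne : ∀ x y, f x ≠ f y → s (x⁻¹ * y) = 0 := fun x y hxy =>
    s_out _ (by rw [map_mul, map_inv, Ne, inv_mul_eq_one]; exact hxy)
  have main : ∀ x y z, (c (f x) (f y) (f z) + (s (x⁻¹ * y) + s (y⁻¹ * z) - s (x⁻¹ * z)) = 0 ∨
      c (f x) (f y) (f z) + (s (x⁻¹ * y) + s (y⁻¹ * z) - s (x⁻¹ * z)) = 1 ∨
      c (f x) (f y) (f z) + (s (x⁻¹ * y) + s (y⁻¹ * z) - s (x⁻¹ * z)) = -1) ∧
      (c (f x) (f y) (f z) + (s (x⁻¹ * y) + s (y⁻¹ * z) - s (x⁻¹ * z)) = 0 ↔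
        x = y ∨ x = z ∨ y = z) := fun x y z => by
    have hv := h1 (f x) (f y) (f z)
    have h0 := h2 (f x) (f y) (f z)
    have hne : ∀ u v : B, f u ≠ f v → u ≠ v := fun u v h e => h (e ▸ rfl)
    by_cases hxy : f x = f y
    · rw [h0.2 (Or.inl hxy), zero_add]
      by_cases hyz : f y = f z
      · rw [← s_eq x y hxy, ← s_eq y z hyz, ← s_eq x z (hxy.trans hyz)]
        exact key x y z hxy hyz
      · have hxz : f x ≠ f z := hxy ▸ hyz
        have := hne _ _ hyz
        have := hne _ _ hxz
        have := s_val (x⁻¹ * y)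
        rw [s_ne _ _ hyz, s_ne _ _ hxz, ← s_eq x y hxy]
        simp only [*, or_false]
        omega
    · have nxy := hne _ _ hxy
      rw [s_ne _ _ hxy]
      by_cases hyz : f y = f z
      · have hxz : f x ≠ f z := hyz ▸ hxy
        have := hne _ _ hxz
        rw [s_ne _ _ hxz, h0.2 (Or.inr (Or.inr hyz))]
        have := s_val (y⁻¹ * z)
        rw [← s_eq y z hyz]
        simp only [*, false_or]
        omega
      · have := hne _ _ hyz
        rw [s_ne _ _ hyz]
        by_cases hxz : f x = f z
        · rw [h0.2 (Or.inr (Or.inl hxz))]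
          have := s_val (x⁻¹ * z)
          rw [← s_eq x z hxz]
          simp only [*, or_false, false_or]
          omega
        · have := hne _ _ hxz
          rw [s_ne _ _ hxz]
          have hc0 : c (f x) (f y) (f z) ≠ 0 := by simp [h0, hxy, hxz, hyz]
          simp only [*, or_false, iff_false]
          omega
  refine ⟨fun x y z => c (f x) (f y) (f z) + (s (x⁻¹ * y) + s (y⁻¹ * z) - s (x⁻¹ * z)),
    fun x y z => (main x y z).1, fun x y z => (main x y z).2, fun x y z w => ?_,
    fun h x y z => ?_⟩
  · have := h3 (f x) (f y) (f z) (f w)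
    dsimp only
    omega
  · simp only [map_mul, h4, mul_inv_rev]
    have e : ∀ u v : B, u⁻¹ * h⁻¹ * (h * v) = u⁻¹ * v := fun u v => by group
    simp only [e]

open Filter in
/-- A group is circularly-orderable if every finite subset lies in a circularly-orderable
subgroup. -/
theorem of_forall_finset {H : Type*} [Group H]
    (h : ∀ S : Finset H, ∃ K : Subgroup H, (S : Set H) ⊆ K ∧ CircularlyOrderable K) :
    CircularlyOrderable H := by
  classical
  choose K hSK c hc using h
  let U : Ultrafilter (Finset H) := Ultrafilter.of atTop
  have hmem : ∀ x : H, ∀ᶠ S in (U : Filter (Finset H)), x ∈ K S := fun x =>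
    (Ultrafilter.of_le atTop) ((eventually_ge_atTop {x}).mono fun S hS =>
      hSK S (by simpa using hS))
  let d : Finset H → H → H → H → ℤ := fun S x y z =>
    if hx : x ∈ K S ∧ y ∈ K S ∧ z ∈ K S then c S ⟨x, hx.1⟩ ⟨y, hx.2.1⟩ ⟨z, hx.2.2⟩ else 0
  have d_eq : ∀ S x y z (hx : x ∈ K S) (hy : y ∈ K S) (hz : z ∈ K S),
      d S x y z = c S ⟨x, hx⟩ ⟨y, hy⟩ ⟨z, hz⟩ := fun S x y z hx hy hz => dif_pos ⟨hx, hy, hz⟩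
  have hlim : ∀ x y z, ∃ v : ℤ, ∀ᶠ S in (U : Filter (Finset H)), d S x y z = v := by
    intro x y z
    have : ∀ᶠ S in (U : Filter (Finset H)),
        d S x y z = 0 ∨ d S x y z = 1 ∨ d S x y z = -1 := by
      refine Eventually.of_forall fun S => ?_
      by_cases hx : x ∈ K S ∧ y ∈ K S ∧ z ∈ K S
      · rw [d_eq S x y z hx.1 hx.2.1 hx.2.2]
        exact (hc S).1 _ _ _
      · exact Or.inl (dif_neg hx)
    rw [Ultrafilter.eventually_or, Ultrafilter.eventually_or] at this
    rcases this with h | h | h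
    exacts [⟨_, h⟩, ⟨_, h⟩, ⟨_, h⟩]
  choose e he using hlim
  refine ⟨e, fun x y z => ?_, fun x y z => ?_, fun x y z w => ?_, fun g x y z => ?_⟩
  · obtain ⟨S, h1, hx, hy, hz⟩ :=
      ((he x y z).and ((hmem x).and ((hmem y).and (hmem z)))).exists
    rw [← h1, d_eq S x y z hx hy hz]
    exact (hc S).1 _ _ _
  · obtain ⟨S, h1, hx, hy, hz⟩ :=
      ((he x y z).and ((hmem x).and ((hmem y).and (hmem z)))).exists
    rw [← h1, d_eq S x y z hx hy hz, (hc S).2.1]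
    simp
  · obtain ⟨S, h1, h2, h3, h4, hx, hy, hz, hw⟩ :=
      ((he y z w).and ((he x z w).and ((he x y w).and ((he x y z).and
        ((hmem x).and ((hmem y).and ((hmem z).and (hmem w)))))))).exists
    rw [← h1, ← h2, ← h3, ← h4, d_eq S _ _ _ hy hz hw, d_eq S _ _ _ hx hz hw,
      d_eq S _ _ _ hx hy hw, d_eq S _ _ _ hx hy hz]
    exact (hc S).2.2.1 _ _ _ _
  · obtain ⟨S, h1, h2, hx, hy, hz, hg⟩ :=
      ((he (g * x) (g * y) (g * z)).and ((he x y z).and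
        ((hmem x).and ((hmem y).and ((hmem z).and (hmem g)))))).exists
    rw [← h1, ← h2, d_eq S _ _ _ hx hy hz, d_eq S _ _ _ (mul_mem hg hx) (mul_mem hg hy)
      (mul_mem hg hz)]
    exact (hc S).2.2.2 ⟨g, hg⟩ ⟨x, hx⟩ ⟨y, hy⟩ ⟨z, hz⟩

/-- Finite cyclic groups are circularly-orderable. -/
theorem zmod (n : ℕ) [NeZero n] : CircularlyOrderable (Multiplicative (ZMod n)) := by
  let v : Multiplicative (ZMod n) → ℤ := fun x => ((x.toAdd).val : ℤ)
  have hv : ∀ x y, v x = v y ↔ x = y := fun x y =>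
    Nat.cast_inj.trans ((ZMod.val_injective n).eq_iff.trans Multiplicative.toAdd.injective.eq_iff)
  have hlt : ∀ x, 0 ≤ v x ∧ v x < n := fun x =>
    ⟨Int.natCast_nonneg _, Int.ofNat_lt.2 (ZMod.val_lt _)⟩
  have hmul : ∀ x y, (v x + v y < n ∧ v (x * y) = v x + v y) ∨
      (n ≤ v x + v y ∧ v (x * y) = v x + v y - n) := fun x y => by
    rcases lt_or_ge (x.toAdd.val + y.toAdd.val) n with h | h
    · have := ZMod.val_add_of_lt h
      refine Or.inl ⟨?_, ?_⟩ <;> simp only [v, toAdd_mul] <;> omega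
    · have := ZMod.val_add_val_of_le h
      refine Or.inr ⟨?_, ?_⟩ <;> simp only [v, toAdd_mul] <;> omega
  let s : ℤ → ℤ → ℤ := fun a b => if a < b then 1 else if b < a then -1 else 0
  refine ⟨fun x y z => s (v x) (v y) + s (v y) (v z) - s (v x) (v z), fun x y z => ?_,
    fun x y z => ?_, fun x y z w => by dsimp only; omega, fun h x y z => ?_⟩
  · simp only [s]; split_ifs <;> omega
  · simp only [s, ← hv]; split_ifs <;> omega
  · let w : Multiplicative (ZMod n) → ℤ := fun x => if v h + v x < n then 0 else 2
    have hs : ∀ x y, s (v (h * x)) (v (h * y)) = s (v x) (v y) + w x - w y := fun x y => by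
      have := hlt x
      have := hlt y
      have := hlt h
      have := hmul h x
      have := hmul h y
      simp only [s, w]
      split_ifs <;> omega
    simp only [hs]
    ring

/-- A finite circularly-orderable group is cyclic. -/
theorem isCyclic_of_finite {H : Type*} [Group H] [Finite H] (hH : CircularlyOrderable H) :
    IsCyclic H := by
  obtain ⟨c, hc⟩ := hH
  rcases subsingleton_or_nontrivial H with _ | _
  · infer_instance
  have h1 := hc.1
  have h2 := hc.2.1
  have h3 := hc.2.2.1
  have hwf : WellFounded fun x y : H => c 1 x y = 1 := by
    have : IsTrans H fun x y => c 1 x y = 1 := ⟨fun x y z hxy hyz => by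
      have := h3 1 x y z
      have := h1 x y z
      have := h1 1 x z
      have h0 := (h2 1 x z).1
      by_cases hxz : c 1 x z = 0
      · rcases h0 hxz with h | h | h
        · have := (h2 1 x y).2 (Or.inl h); omega
        · have := (h2 1 y z).2 (Or.inr (Or.inl h)); omega
        · subst h; have := hc.swap_right 1 x y; omega
      · omega⟩
    have : Std.Irrefl fun x y : H => c 1 x y = 1 := ⟨fun x hx => by
      have := (h2 1 x x).2 (by simp)
      omega⟩
    exact Finite.wellFounded_of_trans_of_irrefl _
  obtain ⟨g, hg, hmin⟩ := hwf.has_min {x : H | x ≠ 1} (exists_ne 1)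
  have hsucc : ∀ y : H, y ≠ 1 → y ≠ g → c 1 g y = 1 := fun y hy hyg => by
    have a := hmin y hy
    have b := hc.swap_right 1 y g
    have := h1 1 g y
    have d := (h2 1 g y).1
    by_cases h : c 1 g y = 0
    · rcases d h with h | h | h
      exacts [absurd h.symm hg, absurd h.symm hy, absurd h.symm hyg]
    · omega
  refine ⟨⟨g, fun x => ?_⟩⟩
  by_contra hx
  obtain ⟨x, hx, hmin'⟩ := hwf.has_min {x : H | x ∉ Subgroup.zpowers g} ⟨x, hx⟩
  have hx1 : x ≠ 1 := fun h => hx (h ▸ one_mem _)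
  have hg1 : x * g⁻¹ ∉ Subgroup.zpowers g := fun h =>
    hx (by simpa using mul_mem h (Subgroup.mem_zpowers g))
  have h4 := hmin' _ hg1
  have h5 : c (x * g⁻¹) x 1 = 1 := by
    rw [← hsucc (g * x⁻¹) (fun h => hg1 ?_) (fun h => hx1 (by simpa using h)),
      ← hc.2.2.2 (x * g⁻¹) 1 g]
    · simp
    · rw [← inv_mem_iff]; simp [h]
  have a := hc.swap_left 1 (x * g⁻¹) x
  have b := hc.swap_right (x * g⁻¹) x 1
  omega

end CircularlyOrderable

section BiOrderedGroup

variable {E : Type*} [Group E]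

variable [LinearOrder E]

/-- The elements of `E` above a rational power of `z`, with exponent prescribed by `f`. -/
def IsAboveRatPow (z : E) (f : E →* Multiplicative ℚ) (x : E) : Prop :=
  ∃ (q : ℕ) (p : ℤ), q ≠ 0 ∧ q * (f x).toAdd = p ∧ z ^ p < x ^ q

theorem not_isAboveRatPow_zpow {z : E} {f : E →* Multiplicative ℚ}
    (hf : f z = Multiplicative.ofAdd 1) (k : ℤ) : ¬ IsAboveRatPow z f (z ^ k) := by
  rintro ⟨q, p, hq, h, hlt⟩
  rw [map_zpow, hf, ← ofAdd_zsmul, toAdd_ofAdd] at h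
  have : (q : ℤ) * k = p := by
    have : (q : ℚ) * k = p := by simpa using h
    exact_mod_cast this
  rw [← zpow_natCast, ← zpow_mul, ← this, mul_comm] at hlt
  exact lt_irrefl _ hlt

variable [MulLeftMono E]

theorem zpow_strictMono_of_one_lt {z : E} (hz : 1 < z) : StrictMono fun n : ℤ => z ^ n :=
  strictMono_int_of_lt_succ fun n => by
    rw [zpow_add_one]
    exact lt_mul_of_one_lt_right' _ hz

variable [MulRightMono E]

theorem pow_mul_le_mul_pow_of_mul_le {x y : E} (h : x * y ≤ y * x) (n : ℕ) :
    x ^ n * y ≤ y * x ^ n := by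
  induction n with
  | zero => simp
  | succ n ih =>
    calc x ^ (n + 1) * y = x ^ n * (x * y) := by rw [pow_succ, mul_assoc]
      _ ≤ x ^ n * (y * x) := by gcongr
      _ = (x ^ n * y) * x := by rw [mul_assoc]
      _ ≤ (y * x ^ n) * x := by gcongr
      _ = y * x ^ (n + 1) := by rw [pow_succ, mul_assoc]

theorem mul_pow_le_mul_pow_of_mul_le {x y : E} (h : x * y ≤ y * x) (n : ℕ) :
    x * y ^ n ≤ y ^ n * x := by
  induction n with
  | zero => simp
  | succ n ih =>
    calc x * y ^ (n + 1) = (x * y ^ n) * y := by rw [pow_succ, mul_assoc]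
      _ ≤ (y ^ n * x) * y := by gcongr
      _ = y ^ n * (x * y) := by rw [mul_assoc]
      _ ≤ y ^ n * (y * x) := by gcongr
      _ = y ^ (n + 1) * x := by rw [pow_succ, mul_assoc]

theorem mul_pow_le_pow_mul_pow_of_mul_le {x y : E} (h : x * y ≤ y * x) (n : ℕ) :
    (x * y) ^ n ≤ y ^ n * x ^ n := by
  induction n with
  | zero => simp
  | succ n ih =>
    calc (x * y) ^ (n + 1) = (x * y) * (x * y) ^ n := pow_succ' _ _
      _ ≤ (x * y) * (y ^ n * x ^ n) := by gcongr
      _ = (x * y ^ (n + 1)) * x ^ n := by rw [pow_succ']; group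
      _ ≤ (y ^ (n + 1) * x) * x ^ n := by
        exact mul_le_mul_left (mul_pow_le_mul_pow_of_mul_le h _) _
      _ = y ^ (n + 1) * x ^ (n + 1) := by rw [pow_succ' x, mul_assoc]

theorem pow_mul_pow_le_mul_pow_of_mul_le {x y : E} (h : x * y ≤ y * x) (n : ℕ) :
    x ^ n * y ^ n ≤ (x * y) ^ n := by
  induction n with
  | zero => simp
  | succ n ih =>
    calc x ^ (n + 1) * y ^ (n + 1) = x * (x ^ n * y) * y ^ n := by
          rw [pow_succ' x, pow_succ' y]; simp only [mul_assoc]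
      _ ≤ x * (y * x ^ n) * y ^ n := by
        exact mul_le_mul_left (mul_le_mul_right (pow_mul_le_mul_pow_of_mul_le h _) _) _
      _ = x * y * (x ^ n * y ^ n) := by simp only [mul_assoc]
      _ ≤ x * y * (x * y) ^ n := by gcongr
      _ = (x * y) ^ (n + 1) := (pow_succ' _ _).symm

/-- In a bi-ordered group, `(x * y) ^ n` lies between `x ^ n * y ^ n` and `y ^ n * x ^ n`. -/
theorem mul_pow_mem_uIcc (x y : E) (n : ℕ) :
    (x * y) ^ n ∈ Set.uIcc (x ^ n * y ^ n) (y ^ n * x ^ n) := by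
  rcases le_total (x * y) (y * x) with h | h
  · exact Set.mem_uIcc.2 (Or.inl
      ⟨pow_mul_pow_le_mul_pow_of_mul_le h n, mul_pow_le_pow_mul_pow_of_mul_le h n⟩)
  · have h' : OrderDual.toDual x * OrderDual.toDual y ≤ OrderDual.toDual y * OrderDual.toDual x := h
    exact Set.mem_uIcc.2 (Or.inr ⟨mul_pow_le_pow_mul_pow_of_mul_le h' n,
      pow_mul_pow_le_mul_pow_of_mul_le h' n⟩)

open Filter Topology in
/-- A bi-ordered group with a cofinal element `z` has a homomorphism to `ℝ` sending `z` to `1`. -/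
theorem exists_real_of_floor {z : E} (hz : 1 < z)
    (hfloor : ∀ x : E, ∃ n : ℤ, z ^ n ≤ x ∧ x < z ^ (n + 1)) :
    ∃ φ : E → ℝ, (∀ x y, φ (x * y) = φ x + φ y) ∧ φ z = 1 := by
  choose fl hle hlt using hfloor
  have hsm := zpow_strictMono_of_one_lt hz
  have le_fl : ∀ {k : ℤ} {x : E}, z ^ k ≤ x → k ≤ fl x := fun h =>
    Int.lt_add_one_iff.1 (hsm.lt_iff_lt.1 (h.trans_lt (hlt _)))
  have fl_lt : ∀ {k : ℤ} {x : E}, x < z ^ k → fl x < k := fun h =>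
    hsm.lt_iff_lt.1 ((hle _).trans_lt h)
  have fl_mono : Monotone fl := fun x y h => le_fl ((hle x).trans h)
  have fl_mul_ge : ∀ x y, fl x + fl y ≤ fl (x * y) := fun x y => le_fl (by
    rw [zpow_add]; exact mul_le_mul' (hle x) (hle y))
  have fl_mul_le : ∀ x y, fl (x * y) ≤ fl x + fl y + 1 := fun x y => by
    have : x * y < z ^ ((fl x + 1) + (fl y + 1)) := by
      rw [zpow_add]; exact mul_lt_mul_of_lt_of_lt (hlt x) (hlt y)
    have := fl_lt this
    omega
  have fl_pow_le : ∀ x (n : ℕ), fl (x ^ n) ≤ (fl x + 1) * n := fun x n => by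
    have : x ^ n ≤ z ^ ((fl x + 1) * n) := by
      rw [zpow_mul, zpow_natCast]; exact pow_le_pow_left' (hlt x).le n
    exact Int.lt_add_one_iff.1 (fl_lt (this.trans_lt (hsm (lt_add_one _))))
  have hsub : ∀ x, Subadditive fun n => -(fl (x ^ n) : ℝ) := fun x m n => by
    have := fl_mul_ge (x ^ m) (x ^ n)
    rw [← pow_add] at this
    have : (fl (x ^ m) : ℝ) + fl (x ^ n) ≤ fl (x ^ (m + n)) := by exact_mod_cast this
    dsimp only
    linarith
  have hbdd : ∀ x, BddBelow (Set.range fun n : ℕ => -(fl (x ^ n) : ℝ) / n) := fun x => by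
    refine ⟨-|(fl x : ℝ) + 1|, ?_⟩
    rintro _ ⟨n, rfl⟩
    rcases Nat.eq_zero_or_pos n with rfl | hn
    · simp
    · have hn' : (0 : ℝ) < n := by exact_mod_cast hn
      have h1 : (fl (x ^ n) : ℝ) ≤ (fl x + 1) * n := by exact_mod_cast fl_pow_le x n
      have h2 := le_abs_self ((fl x : ℝ) + 1)
      dsimp only
      rw [le_div_iff₀ hn']
      nlinarith
  have hlim : ∀ x, ∃ l : ℝ, Tendsto (fun n : ℕ => (fl (x ^ n) : ℝ) / n) atTop (𝓝 l) := fun x =>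
    ⟨_, by simpa [neg_div] using ((hsub x).tendsto_lim (hbdd x)).neg⟩
  choose φ hφ using hlim
  refine ⟨φ, fun x y => ?_, ?_⟩
  · have h1 : ∀ n : ℕ, |(fl ((x * y) ^ n) : ℝ) - fl (x ^ n) - fl (y ^ n)| ≤ 1 := fun n => by
      have a := fl_mul_ge (x ^ n) (y ^ n)
      have b := fl_mul_le (x ^ n) (y ^ n)
      have a' := fl_mul_ge (y ^ n) (x ^ n)
      have b' := fl_mul_le (y ^ n) (x ^ n)
      have h : |fl ((x * y) ^ n) - fl (x ^ n) - fl (y ^ n)| ≤ 1 := by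
        rw [abs_le]
        rcases Set.mem_uIcc.1 (mul_pow_mem_uIcc x y n) with ⟨h, h'⟩ | ⟨h, h'⟩ <;>
          have := fl_mono h <;> have := fl_mono h' <;> constructor <;> omega
      exact_mod_cast h
    have h2 : Tendsto (fun n : ℕ => ((fl ((x * y) ^ n) : ℝ) - fl (x ^ n) - fl (y ^ n)) / n)
        atTop (𝓝 0) := by
      refine squeeze_zero_norm (fun n => ?_) tendsto_one_div_atTop_nhds_zero_nat
      rw [norm_div, Real.norm_eq_abs, Real.norm_natCast]
      exact div_le_div_of_nonneg_right (h1 n) n.cast_nonneg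
    have h3 := ((hφ (x * y)).sub (hφ x)).sub (hφ y)
    have h4 := tendsto_nhds_unique h3 (h2.congr fun n => by ring)
    linarith
  · have hflz : ∀ n : ℕ, fl (z ^ n) = n := fun n => by
      have h1 : (n : ℤ) ≤ fl (z ^ n) := le_fl (by simp)
      have h2 : fl (z ^ n) < n + 1 := fl_lt (by
        rw [← zpow_natCast]; exact hsm (lt_add_one _))
      omega
    refine tendsto_nhds_unique (hφ z) (tendsto_const_nhds.congr' ?_)
    filter_upwards [eventually_ne_atTop 0] with n hn
    rw [hflz]
    have : (n : ℝ) ≠ 0 := by exact_mod_cast hn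
    simp [this]

/-- A bi-ordered group with a cofinal element `z` has a homomorphism to `ℚ` sending `z` to `1`. -/
theorem exists_monoidHom_rat_of_floor {z : E} (hz : 1 < z)
    (hfloor : ∀ x : E, ∃ n : ℤ, z ^ n ≤ x ∧ x < z ^ (n + 1)) :
    ∃ f : E →* Multiplicative ℚ, f z = Multiplicative.ofAdd 1 := by
  obtain ⟨φ, hφ, hφz⟩ := exists_real_of_floor hz hfloor
  obtain ⟨r, hr⟩ := (LinearMap.toSpanSingleton ℚ ℝ 1).exists_leftInverse_of_injective
    (LinearMap.ker_eq_bot.2 fun a b h => by simpa using h)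
  refine ⟨MonoidHom.mk' (fun x => Multiplicative.ofAdd (r (φ x))) fun x y => ?_, ?_⟩
  · rw [hφ, map_add, ofAdd_add]
  · have := LinearMap.congr_fun hr 1
    simpa [hφz] using this

theorem IsAboveRatPow.mul {z : E} {f : E →* Multiplicative ℚ} {x y : E}
    (hx : IsAboveRatPow z f x) (hy : IsAboveRatPow z f y) : IsAboveRatPow z f (x * y) := by
  obtain ⟨q, p, hq, hf, hlt⟩ := hx
  obtain ⟨q', p', hq', hf', hlt'⟩ := hy
  have e : z ^ (p * q') < x ^ (q * q') := by
    rw [zpow_mul, zpow_natCast, pow_mul]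
    exact pow_left_strictMono hq' hlt
  have e' : z ^ (p' * q) < y ^ (q * q') := by
    rw [zpow_mul, zpow_natCast, mul_comm q, pow_mul]
    exact pow_left_strictMono hq hlt'
  refine ⟨q * q', p * q' + p' * q, mul_ne_zero hq hq', ?_, ?_⟩
  · rw [map_mul, toAdd_mul]
    push_cast
    rw [← hf, ← hf']
    ring
  · have h1 : z ^ (p * q' + p' * q) < x ^ (q * q') * y ^ (q * q') := by
      rw [zpow_add]; exact mul_lt_mul_of_lt_of_lt e e'
    have h2 : z ^ (p * q' + p' * q) < y ^ (q * q') * x ^ (q * q') := by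
      rw [add_comm, zpow_add]; exact mul_lt_mul_of_lt_of_lt e' e
    exact (lt_min h1 h2).trans_le (mul_pow_mem_uIcc x y (q * q')).1

theorem exists_pow_eq_zpow_or_isAboveRatPow (z : E) (f : E →* Multiplicative ℚ) (x : E) :
    (∃ (q : ℕ) (p : ℤ), q ≠ 0 ∧ x ^ q = z ^ p) ∨ IsAboveRatPow z f x ∨
      IsAboveRatPow z f x⁻¹ := by
  obtain ⟨q, p, hq, h⟩ : ∃ (q : ℕ) (p : ℤ), q ≠ 0 ∧ q * (f x).toAdd = p :=
    ⟨(f x).toAdd.den, (f x).toAdd.num, Rat.den_ne_zero _, Rat.den_mul_eq_num _⟩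
  rcases lt_trichotomy (z ^ p) (x ^ q) with hlt | heq | hlt
  · exact Or.inr (Or.inl ⟨q, p, hq, h, hlt⟩)
  · exact Or.inl ⟨q, p, hq, heq.symm⟩
  · refine Or.inr (Or.inr ⟨q, -p, hq, ?_, ?_⟩)
    · rw [map_inv, toAdd_inv, mul_neg, h, Int.cast_neg]
    · rw [zpow_neg, inv_pow]
      exact inv_lt_inv_iff.2 hlt

end BiOrderedGroup

section CentralExtension

variable {A : Type*}

open Classical in
/-- The indicator of `u` strictly preceding `v` in the linear order obtained by cutting the circular
ordering `c` at `p`, whose least element is `p`. -/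
noncomputable def cutLT (c : A → A → A → ℤ) (p u v : A) : ℤ :=
  if c p u v = 1 ∨ (u = p ∧ v ≠ p) then 1 else 0

theorem cutLT_eq (c : A → A → A → ℤ) (p u v : A) : cutLT c p u v = 0 ∨ cutLT c p u v = 1 := by
  unfold cutLT
  split_ifs <;> simp

theorem cutLT_congr {c : A → A → A → ℤ} {p u v p' u' v' : A}
    (h : (c p u v = 1 ∨ (u = p ∧ v ≠ p)) ↔ (c p' u' v' = 1 ∨ (u' = p' ∧ v' ≠ p'))) :
    cutLT c p u v = cutLT c p' u' v' := by
  unfold cutLT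
  by_cases h' : c p u v = 1 ∨ (u = p ∧ v ≠ p)
  · rw [if_pos h', if_pos (h.1 h')]
  · rw [if_neg h', if_neg (mt h.2 h')]

variable [Group A] {c : A → A → A → ℤ}

namespace IsHomCircularOrdering

theorem cutLT_mul_left (hc : IsHomCircularOrdering c) (h p u v : A) :
    cutLT c (h * p) (h * u) (h * v) = cutLT c p u v := by
  refine cutLT_congr ?_
  simp [hc.2.2.2]

theorem cutLT_self_left (_hc : IsHomCircularOrdering c) {p v : A} (h : v ≠ p) :
    cutLT c p p v = 1 := by
  simp [cutLT, h]

theorem cutLT_self_right (hc : IsHomCircularOrdering c) (p u : A) : cutLT c p u p = 0 := by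
  have := (hc.2.1 p u p).2 (by simp)
  simp [cutLT, this]

theorem cutLT_irrefl (hc : IsHomCircularOrdering c) (p u : A) : cutLT c p u u = 0 := by
  have := (hc.2.1 p u u).2 (by simp)
  rw [cutLT, if_neg]
  rintro (h | ⟨h, h'⟩)
  · omega
  · exact h' h

theorem cutLT_add_swap (hc : IsHomCircularOrdering c) {p u v : A} (h : u ≠ v) :
    cutLT c p u v + cutLT c p v u = 1 := by
  by_cases hu : u = p
  · subst hu
    rw [hc.cutLT_self_left h.symm, hc.cutLT_self_right, add_zero]
  by_cases hv : v = p
  · subst hv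
    rw [hc.cutLT_self_left h, hc.cutLT_self_right, zero_add]
  have h0 : c p u v ≠ 0 := by
    rw [Ne, hc.2.1]
    rintro (e | e | e)
    exacts [hu e.symm, hv e.symm, h e]
  have h1 := hc.1 p u v
  have h2 := hc.swap_right p u v
  simp only [cutLT, hu, hv, false_and, or_false]
  split_ifs <;> omega

theorem cutLT_cocycle (hc : IsHomCircularOrdering c) (p₀ p₁ p₂ p₃ : A) :
    cutLT c p₁ p₃ p₂ + cutLT c p₀ p₃ p₁ = cutLT c p₀ p₂ p₁ + cutLT c p₀ p₃ p₂ := by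
  by_cases h01 : p₀ = p₁
  · subst h01
    rw [hc.cutLT_self_right, hc.cutLT_self_right]
    ring
  by_cases h23 : p₂ = p₃
  · subst h23
    rw [hc.cutLT_irrefl, hc.cutLT_irrefl]
    ring
  by_cases h12 : p₁ = p₂
  · subst h12
    rw [hc.cutLT_self_right, hc.cutLT_irrefl]
  by_cases h13 : p₁ = p₃
  · subst h13
    rw [hc.cutLT_irrefl, hc.cutLT_self_left (Ne.symm h12), ← hc.cutLT_add_swap h12]
    ring
  have e1 := hc.2.2.1 p₀ p₁ p₂ p₃
  have v1 := hc.1 p₁ p₂ p₃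
  have n1 : c p₁ p₂ p₃ ≠ 0 := by simp [hc.2.1, *]
  have s1 := hc.swap_right p₁ p₂ p₃
  have s2 := hc.swap_right p₀ p₁ p₃
  have s3 := hc.swap_right p₀ p₁ p₂
  have s4 := hc.swap_right p₀ p₂ p₃
  by_cases h02 : p₀ = p₂
  · subst h02
    rw [hc.cutLT_self_right, hc.cutLT_self_left (Ne.symm h01)]
    have z1 := (hc.2.1 p₀ p₁ p₀).2 (by simp)
    have z2 := (hc.2.1 p₀ p₀ p₃).2 (by simp)
    simp only [cutLT, Ne.symm h13, Ne.symm h23, false_and, or_false]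
    split_ifs <;> omega
  by_cases h03 : p₀ = p₃
  · subst h03
    rw [hc.cutLT_self_left (Ne.symm h01), hc.cutLT_self_left (Ne.symm h02)]
    have z1 := (hc.2.1 p₀ p₁ p₀).2 (by simp)
    have z2 := (hc.2.1 p₀ p₂ p₀).2 (by simp)
    simp only [cutLT, Ne.symm h02, h01, false_and, or_false]
    split_ifs <;> omega
  have v2 := hc.1 p₀ p₁ p₂
  have n2 : c p₀ p₁ p₂ ≠ 0 := by simp [hc.2.1, *]
  have v3 := hc.1 p₀ p₁ p₃
  have n3 : c p₀ p₁ p₃ ≠ 0 := by simp [hc.2.1, *]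
  have v4 := hc.1 p₀ p₂ p₃
  have n4 : c p₀ p₂ p₃ ≠ 0 := by simp [hc.2.1, *]
  simp only [cutLT, Ne.symm h13, Ne.symm h03, Ne.symm h02, false_and, or_false]
  split_ifs <;> omega

/-- The inhomogeneous `{0, 1}`-valued cocycle associated with the circular ordering. -/
noncomputable def wrap (_hc : IsHomCircularOrdering c) (a b : A) : ℤ := cutLT c 1 (a * b) a

theorem wrap_eq (hc : IsHomCircularOrdering c) (a b : A) : hc.wrap a b = 0 ∨ hc.wrap a b = 1 :=
  cutLT_eq _ _ _ _

theorem wrap_one_left (hc : IsHomCircularOrdering c) (a : A) : hc.wrap 1 a = 0 :=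
  hc.cutLT_self_right _ _

theorem wrap_inv_right (hc : IsHomCircularOrdering c) {a : A} (h : a ≠ 1) :
    hc.wrap a a⁻¹ = 1 := by
  rw [wrap, mul_inv_cancel, hc.cutLT_self_left h]

theorem wrap_inv_left (hc : IsHomCircularOrdering c) (a : A) :
    hc.wrap a⁻¹ a = hc.wrap a a⁻¹ := by
  by_cases h : a = 1
  · simp [h]
  · rw [hc.wrap_inv_right h]
    simpa using hc.wrap_inv_right (inv_ne_one.2 h)

theorem wrap_cocycle (hc : IsHomCircularOrdering c) (a b d : A) :
    hc.wrap b d + hc.wrap a (b * d) = hc.wrap a b + hc.wrap (a * b) d := by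
  have h := hc.cutLT_cocycle 1 a (a * b) (a * b * d)
  rw [wrap, ← hc.cutLT_mul_left a, mul_one, wrap, wrap, wrap]
  simpa only [mul_assoc] using h

end IsHomCircularOrdering

namespace IsBiInvariantCircularOrdering

theorem wrap_conj (hc : IsBiInvariantCircularOrdering c) (g a b : A) :
    hc.1.wrap (g * a * g⁻¹) (g * b * g⁻¹) = hc.1.wrap a b := by
  have e : g * a * g⁻¹ * (g * b * g⁻¹) = g * (a * b) * g⁻¹ := by group
  have h : ∀ x y, c 1 (g * x * g⁻¹) (g * y * g⁻¹) = c 1 x y := fun x y => by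
    rw [← hc.1.2.2.2 g 1 x y, ← hc.2 g⁻¹ (g * 1)]
    simp
  refine cutLT_congr ?_
  rw [e, h, conj_eq_one_iff, Ne, conj_eq_one_iff]

theorem wrap_comm (hc : IsBiInvariantCircularOrdering c) (a b : A) :
    hc.1.wrap a b = hc.1.wrap b a := by
  have hconj : ∀ x y, hc.1.wrap (b * x * b⁻¹) (b * y * b⁻¹) = hc.1.wrap x y := hc.wrap_conj b
  set u := b⁻¹ * a * b with hu
  set v := b⁻¹ * u * b with hv
  have hau : a = b * u * b⁻¹ := by rw [hu]; group
  have huv : u = b * v * b⁻¹ := by rw [hv]; group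
  have hb : b = b * b * b⁻¹ := by group
  have h1 : hc.1.wrap u b = hc.1.wrap a b := by rw [← hconj, ← hau, ← hb]
  have h2 : hc.1.wrap b u = hc.1.wrap b a := by rw [← hconj, ← hau, ← hb]
  have h3 : hc.1.wrap b v = hc.1.wrap b a := by rw [← hconj, ← huv, ← hb, h2]
  have e1 : a * b = b * u := by rw [hu]; group
  have e2 : u * b = b * v := by rw [hv]; group
  have c1 := hc.1.wrap_cocycle a b b
  have c2 := hc.1.wrap_cocycle b u b
  have c3 := hc.1.wrap_cocycle b b v
  rw [e1] at c1
  rw [e2] at c2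
  have v1 := hc.1.wrap_eq a (b * b)
  have v2 := hc.1.wrap_eq (b * b) v
  have v3 := hc.1.wrap_eq a b
  have v4 := hc.1.wrap_eq b a
  omega

/-- The central extension of `A` by `ℤ` determined by a bi-invariant circular ordering. -/
@[ext]
structure Lift (hc : IsBiInvariantCircularOrdering c) where
  /-- The image in `A`. -/
  base : A
  /-- The number of full turns. -/
  turns : ℤ

namespace Lift

variable {hc : IsBiInvariantCircularOrdering c}

noncomputable instance : Mul hc.Lift :=
  ⟨fun x y => ⟨x.base * y.base, x.turns + y.turns + hc.1.wrap x.base y.base⟩⟩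

instance : One hc.Lift := ⟨⟨1, 0⟩⟩

noncomputable instance : Inv hc.Lift :=
  ⟨fun x => ⟨x.base⁻¹, -x.turns - hc.1.wrap x.base x.base⁻¹⟩⟩

@[simp] theorem base_mul (x y : hc.Lift) : (x * y).base = x.base * y.base := rfl

@[simp] theorem base_one : (1 : hc.Lift).base = 1 := rfl

@[simp] theorem base_inv (x : hc.Lift) : (x⁻¹).base = x.base⁻¹ := rfl

theorem turns_mul (x y : hc.Lift) :
    (x * y).turns = x.turns + y.turns + hc.1.wrap x.base y.base := rfl

@[simp] theorem turns_one : (1 : hc.Lift).turns = 0 := rfl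

theorem turns_inv (x : hc.Lift) : (x⁻¹).turns = -x.turns - hc.1.wrap x.base x.base⁻¹ := rfl

noncomputable instance : Group hc.Lift :=
  Group.ofLeftAxioms
    (fun x y z => by
      ext
      · simp [mul_assoc]
      · have := hc.1.wrap_cocycle x.base y.base z.base
        simp only [turns_mul, base_mul]
        omega)
    (fun x => by
      ext
      · simp
      · simp [turns_mul, hc.1.wrap_one_left])
    (fun x => by
      ext
      · simp
      · simp only [turns_mul, turns_inv, base_inv, hc.1.wrap_inv_left, turns_one]
        ring)

theorem turns_conj (x y : hc.Lift) : (y * x * y⁻¹).turns = x.turns := by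
  suffices h : y * x * y⁻¹ = ⟨y.base * x.base * y.base⁻¹, x.turns⟩ by rw [h]
  rw [mul_inv_eq_iff_eq_mul]
  ext
  · simp
  · have := hc.wrap_conj y.base x.base y.base
    rw [mul_inv_cancel_right] at this
    simp only [turns_mul, this, hc.wrap_comm x.base]
    ring

noncomputable instance : LinearOrder hc.Lift where
  le x y := 0 ≤ (x⁻¹ * y).turns
  le_refl x := by simp
  le_trans x y z h h' := by
    have e : x⁻¹ * z = (x⁻¹ * y) * (y⁻¹ * z) := by group
    have := hc.1.wrap_eq (x⁻¹ * y).base (y⁻¹ * z).base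
    rw [e, turns_mul]
    omega
  le_antisymm x y h h' := by
    have e : y⁻¹ * x = (x⁻¹ * y)⁻¹ := by group
    rw [e, turns_inv] at h'
    have := hc.1.wrap_eq (x⁻¹ * y).base (x⁻¹ * y).base⁻¹
    refine inv_mul_eq_one.1 (Lift.ext ?_ ?_)
    · by_contra hne
      have := hc.1.wrap_inv_right hne
      omega
    · rw [turns_one]
      omega
  le_total x y := by
    have e : y⁻¹ * x = (x⁻¹ * y)⁻¹ := by group
    rw [e, turns_inv]
    have := hc.1.wrap_eq (x⁻¹ * y).base (x⁻¹ * y).base⁻¹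
    omega
  toDecidableLE := Classical.decRel _

theorem le_iff (x y : hc.Lift) : x ≤ y ↔ 0 ≤ (x⁻¹ * y).turns := Iff.rfl

instance : MulLeftMono hc.Lift :=
  ⟨fun z x y h => by
    rw [le_iff] at *
    simpa [mul_assoc] using h⟩

instance : MulRightMono hc.Lift :=
  ⟨fun z x y h => by
    rw [le_iff] at *
    have e : (x * z)⁻¹ * (y * z) = z⁻¹ * (x⁻¹ * y) * z⁻¹⁻¹ := by group
    show 0 ≤ ((x * z)⁻¹ * (y * z)).turns
    rwa [e, turns_conj]⟩

variable (hc) in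
/-- The projection of the central extension to `A`. -/
noncomputable def proj : hc.Lift →* A := MonoidHom.mk' base base_mul

theorem proj_surjective : Function.Surjective (proj hc) := fun a => ⟨⟨a, 0⟩, rfl⟩

variable (hc) in
/-- The full turn. -/
def turn : hc.Lift := ⟨1, 1⟩

theorem turn_zpow (n : ℤ) : turn hc ^ n = ⟨1, n⟩ := by
  let f : Multiplicative ℤ →* hc.Lift := MonoidHom.mk' (fun k => ⟨1, k.toAdd⟩) fun a b => by
    ext <;> simp [turns_mul, hc.1.wrap_one_left]
  have := map_zpow f (Multiplicative.ofAdd 1) n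
  rw [← ofAdd_zsmul, smul_eq_mul, mul_one] at this
  exact this.symm

theorem proj_eq_one_iff (x : hc.Lift) : proj hc x = 1 ↔ ∃ n : ℤ, x = turn hc ^ n := by
  constructor
  · exact fun h => ⟨x.turns, by rw [turn_zpow]; exact Lift.ext h rfl⟩
  · rintro ⟨n, rfl⟩
    rw [turn_zpow]
    rfl

theorem turns_turn_zpow_inv_mul (n : ℤ) (x : hc.Lift) :
    ((turn hc ^ n)⁻¹ * x).turns = x.turns - n := by
  rw [← zpow_neg, turn_zpow, turns_mul, hc.1.wrap_one_left]
  ring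

theorem one_lt_turn : 1 < turn hc := by
  rw [← not_le, ← zpow_one (turn hc), le_iff, turns_turn_zpow_inv_mul]
  simp

theorem turn_floor (x : hc.Lift) : ∃ n : ℤ, turn hc ^ n ≤ x ∧ x < turn hc ^ (n + 1) := by
  refine ⟨x.turns, ?_, ?_⟩
  · rw [le_iff, turns_turn_zpow_inv_mul]
    omega
  · rw [← not_le, le_iff, turns_turn_zpow_inv_mul]
    omega

end Lift

end IsBiInvariantCircularOrdering

end CentralExtension

/-- The rationals whose denominator is divisible by no prime in `S`. -/
def ratAwayFrom (S : Set ℕ) : AddSubgroup ℚ where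
  carrier := {r | ∀ p ∈ S, p.Prime → ¬ p ∣ r.den}
  zero_mem' := fun p _ hp h => hp.one_lt.ne' (by simpa using h)
  add_mem' := fun {a b} ha hb p hpS hp h =>
    ((hp.dvd_mul).1 (h.trans (Rat.add_den_dvd a b))).elim (ha p hpS hp) (hb p hpS hp)
  neg_mem' := fun {a} ha p hpS hp h => ha p hpS hp (by simpa using h)

theorem mem_ratAwayFrom {S : Set ℕ} {r : ℚ} :
    r ∈ ratAwayFrom S ↔ ∀ p ∈ S, p.Prime → ¬ p ∣ r.den := Iff.rfl

theorem mem_of_prime_dvd_orderOf {S : Set ℕ} {e : Multiplicative (ℚ ⧸ ratAwayFrom S)} {l : ℕ}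
    (hl : l.Prime) (h0 : orderOf e ≠ 0) (hle : l ∣ orderOf e) : l ∈ S := by
  obtain ⟨k, hk⟩ := hle
  have hk0 : k ≠ 0 := by rintro rfl; exact h0 (by simpa using hk)
  obtain ⟨u, hu⟩ := QuotientAddGroup.mk_surjective (e ^ k).toAdd
  have hlu : (l : ℚ) * u ∈ ratAwayFrom S := by
    rw [← QuotientAddGroup.eq_zero_iff, ← nsmul_eq_mul, QuotientAddGroup.mk_nsmul, hu,
      ← toAdd_pow, ← pow_mul, mul_comm, ← hk, pow_orderOf_eq_one, toAdd_one]
  have hu' : u ∉ ratAwayFrom S := by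
    rw [← QuotientAddGroup.eq_zero_iff, hu]
    intro h
    have h1 : e ^ k = 1 := h
    have h2 := Nat.le_of_dvd (Nat.pos_of_ne_zero hk0) (orderOf_dvd_of_pow_eq_one h1)
    have := hl.two_le
    nlinarith [Nat.pos_of_ne_zero hk0]
  rw [mem_ratAwayFrom] at hu'
  push Not at hu'
  obtain ⟨p, hpS, hp, hpu⟩ := hu'
  have hden : u.den ∣ l * ((l : ℚ) * u).den := by
    have h := Rat.mul_den_dvd ((l : ℚ)⁻¹) ((l : ℚ) * u)
    rwa [inv_mul_cancel_left₀ (by exact_mod_cast hl.ne_zero), Rat.inv_natCast_den_of_pos hl.pos]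
      at h
  have hpl : p ∣ l := ((hp.dvd_mul).1 (hpu.trans hden)).resolve_right (hlu p hpS hp)
  rwa [← (Nat.prime_dvd_prime_iff_eq hp hl).1 hpl]

theorem exists_finset_subset_zpowers {N : AddSubgroup ℚ} (hN : 1 ∈ N)
    (T : Finset (Multiplicative (ℚ ⧸ N))) :
    ∃ e : Multiplicative (ℚ ⧸ N), orderOf e ≠ 0 ∧ ∀ t ∈ T, t ∈ Subgroup.zpowers e := by
  choose r hr using fun t : Multiplicative (ℚ ⧸ N) => QuotientAddGroup.mk_surjective t.toAdd
  set M : ℕ := ∏ t ∈ T, (r t).den with hM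
  have hM0 : M ≠ 0 := Finset.prod_ne_zero_iff.2 fun t _ => (r t).den_ne_zero
  have hM0' : (M : ℚ) ≠ 0 := by exact_mod_cast hM0
  refine ⟨Multiplicative.ofAdd ((M : ℚ)⁻¹ : ℚ), ?_, fun t ht => ?_⟩
  · rw [Ne, orderOf_eq_zero_iff, not_not, isOfFinOrder_iff_pow_eq_one]
    refine ⟨M, Nat.pos_of_ne_zero hM0, ?_⟩
    rw [← ofAdd_nsmul, ← QuotientAddGroup.mk_nsmul, nsmul_eq_mul, mul_inv_cancel₀ hM0',
      (QuotientAddGroup.eq_zero_iff (1 : ℚ)).2 hN, ofAdd_zero]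
  · obtain ⟨k, hk⟩ : (r t).den ∣ M := Finset.dvd_prod_of_mem _ ht
    refine Subgroup.mem_zpowers_iff.2 ⟨(r t).num * k, ?_⟩
    have e : ((r t).num * k : ℤ) • (M : ℚ)⁻¹ = r t := by
      have hd : ((r t).den : ℚ) ≠ 0 := by exact_mod_cast (r t).den_ne_zero
      have hM1 : (M : ℚ) = (r t).den * k := by exact_mod_cast hk
      have hk0 : (k : ℚ) ≠ 0 := by rintro h; rw [h, mul_zero] at hM1; exact hM0' hM1
      rw [zsmul_eq_mul, hM1]
      push_cast
      conv_rhs => rw [← Rat.num_div_den (r t)]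
      field_simp
    rw [← ofAdd_zsmul, ← QuotientAddGroup.mk_zsmul, e, hr]
    rfl

namespace CircularlyOrderable

theorem prod_rat_quotient {G : Type*} [Group G] {S : Set ℕ}
    (h : ∀ m : ℕ, m ≠ 0 → (∀ p, p.Prime → p ∣ m → p ∈ S) →
      CircularlyOrderable (G × Multiplicative (ZMod m))) :
    CircularlyOrderable (G × Multiplicative (ℚ ⧸ ratAwayFrom S)) := by
  classical
  refine of_forall_finset fun X => ?_
  obtain ⟨e, he, heX⟩ := exists_finset_subset_zpowers
    (N := ratAwayFrom S) (fun p _ hp h => hp.one_lt.ne' (by simpa using h)) (X.image Prod.snd)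
  refine ⟨(⊤ : Subgroup G).prod (Subgroup.zpowers e), fun x hx => ?_, ?_⟩
  · exact Subgroup.mem_prod.2 ⟨Subgroup.mem_top _, heX _ (Finset.mem_image_of_mem _ hx)⟩
  · have hco := h (Nat.card (Subgroup.zpowers e)) (by rwa [Nat.card_zpowers])
      (fun p hp hpe => mem_of_prime_dvd_orderOf hp he (by rwa [Nat.card_zpowers] at hpe))
    let φ := zmodCyclicMulEquiv (G := Subgroup.zpowers e) inferInstance
    let ψ := (Subgroup.prodEquiv (⊤ : Subgroup G) (Subgroup.zpowers e)).trans
      (Subgroup.topEquiv.prodCongr φ.symm)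
    exact of_injective ψ.toMonoidHom ψ.injective hco

/-- If `A` has a bi-invariant circular ordering and `G × ℤ/m` is circularly-orderable whenever
every prime factor of `m` is the order of an element of `A`, then `G × A` is
circularly-orderable. -/
theorem prod_of_isBiInvariant {G A : Type*} [Group G] [Group A] {c : A → A → A → ℤ}
    (hc : IsBiInvariantCircularOrdering c)
    (h : ∀ m : ℕ, m ≠ 0 → (∀ p, p.Prime → p ∣ m → ∃ a : A, orderOf a = p) →
      CircularlyOrderable (G × Multiplicative (ZMod m))) :
    CircularlyOrderable (G × A) := by
  let S : Set ℕ := {p | ∃ a : A, orderOf a = p}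
  let π := IsBiInvariantCircularOrdering.Lift.proj hc
  have hπ : Function.Surjective π := IsBiInvariantCircularOrdering.Lift.proj_surjective
  have hker : ∀ x, π x = 1 ↔ _ := IsBiInvariantCircularOrdering.Lift.proj_eq_one_iff
  have hz := IsBiInvariantCircularOrdering.Lift.one_lt_turn (hc := hc)
  obtain ⟨f, hf⟩ := exists_monoidHom_rat_of_floor hz IsBiInvariantCircularOrdering.Lift.turn_floor
  set z := IsBiInvariantCircularOrdering.Lift.turn hc
  have hD := prod_rat_quotient (S := S) h
  let g : hc.Lift →* Multiplicative (ℚ ⧸ ratAwayFrom S) :=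
    (AddMonoidHom.toMultiplicative (QuotientAddGroup.mk' (ratAwayFrom S))).comp f
  have hg : ∀ x, g x = 1 ↔ (f x).toAdd ∈ ratAwayFrom S := fun x =>
    QuotientAddGroup.eq_zero_iff _
  have hgz : g z = 1 := by
    rw [hg, hf]
    exact fun p _ hp h => hp.one_lt.ne' (by simpa using h)
  have hgker : π.ker ≤ g.ker := fun x hx => by
    obtain ⟨n, rfl⟩ := (hker x).1 hx
    rw [MonoidHom.mem_ker, map_zpow, hgz, one_zpow]
  let ψ : A →* Multiplicative (ℚ ⧸ ratAwayFrom S) := MonoidHom.liftOfSurjective π hπ ⟨g, hgker⟩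
  have hψ : ∀ x, ψ (π x) = g x := fun x => MonoidHom.liftOfRightInverse_comp_apply _ _ _ _ x
  have htors : ∀ (x : hc.Lift) (q : ℕ) (p : ℤ), q ≠ 0 → x ^ q = z ^ p → g x = 1 → π x = 1 := by
    intro x q p hq hx hgx
    have hπz : ∀ k : ℤ, π (z ^ k) = 1 := fun k => (hker _).2 ⟨k, rfl⟩
    have hfin : orderOf (π x) ≠ 0 := fun h0 => by
      rw [orderOf_eq_zero_iff'] at h0
      exact h0 q (Nat.pos_of_ne_zero hq) (by rw [← map_pow, hx, hπz])
    by_contra hne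
    obtain ⟨l, hl, d, hd⟩ := Nat.exists_prime_and_dvd (mt orderOf_eq_one_iff.1 hne)
    have hd0 : d ≠ 0 := by rintro rfl; exact hfin (by simpa using hd)
    have hxd : π x ^ d ≠ 1 := fun h1 => by
      have h2 := Nat.le_of_dvd (Nat.pos_of_ne_zero hd0) (orderOf_dvd_of_pow_eq_one h1)
      have := hl.two_le
      nlinarith [Nat.pos_of_ne_zero hd0]
    have hlS : l ∈ S := ⟨π x ^ d, by
      have : Fact l.Prime := ⟨hl⟩
      exact orderOf_eq_prime (by rw [← pow_mul, mul_comm, ← hd, pow_orderOf_eq_one]) hxd⟩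
    obtain ⟨k, hk⟩ := (hker (x ^ (l * d))).1 (by rw [map_pow, ← hd, pow_orderOf_eq_one])
    have hfx : ((l * d : ℕ) : ℚ) * (f x).toAdd = k := by
      have := congrArg (fun y => (f y).toAdd) hk
      simpa [hf] using this
    have hnd : ¬ l ∣ (f x).toAdd.den := (hg x).1 hgx l hlS hl
    have hkden : k * ((f x).toAdd.den : ℤ) = ((l * d : ℕ) : ℤ) * (f x).toAdd.num := by
      have : (k : ℚ) * (f x).toAdd.den = ((l * d : ℕ) : ℚ) * (f x).toAdd.num := by
        rw [← hfx, mul_assoc, Rat.mul_den_eq_num]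
      exact_mod_cast this
    have hlk : (l : ℤ) ∣ k := by
      have h1 : (l : ℤ) ∣ k * ((f x).toAdd.den : ℤ) := by
        rw [hkden]
        push_cast
        exact ⟨d * (f x).toAdd.num, by ring⟩
      rcases (Nat.prime_iff_prime_int.1 hl).dvd_mul.1 h1 with h1 | h1
      · exact h1
      · exact absurd (Int.natCast_dvd_natCast.1 h1) hnd
    obtain ⟨j, rfl⟩ := hlk
    have hroot : x ^ d = z ^ j := by
      refine (pow_left_strictMono hl.ne_zero).injective ?_
      rw [← pow_mul, mul_comm, hk, ← zpow_natCast, ← zpow_mul, mul_comm]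
    exact hxd (by rw [← map_pow, hroot, hπz])
  refine of_cone_ker ((MonoidHom.id G).prodMap ψ) hD
    (fun b => b.1 = 1 ∧ ∃ x, π x = b.2 ∧ g x = 1 ∧ IsAboveRatPow z f x) ?_ ?_ ?_ ?_
  · rintro ⟨_, _⟩ ⟨_, _⟩ ⟨rfl, x, rfl, hx, hx'⟩ ⟨rfl, y, rfl, hy, hy'⟩
    exact ⟨mul_one 1, x * y, map_mul _ _ _, by rw [map_mul, hx, hy, mul_one], hx'.mul hy'⟩
  · rintro ⟨_, _⟩ ⟨rfl, x, rfl, hx, -⟩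
    exact Prod.ext rfl ((hψ x).trans hx)
  · rintro ⟨-, x, hx, -, hx'⟩
    obtain ⟨k, rfl⟩ := (hker x).1 hx
    exact not_isAboveRatPow_zpow hf k hx'
  · rintro ⟨u, a⟩ hb
    obtain ⟨x, rfl⟩ := hπ a
    obtain ⟨rfl, hx⟩ : u = 1 ∧ ψ (π x) = 1 := Prod.ext_iff.1 hb
    rw [hψ] at hx
    rcases exists_pow_eq_zpow_or_isAboveRatPow z f x with ⟨q, p, hq, hqp⟩ | hpos | hneg
    · exact Or.inl (Prod.ext rfl (htors x q p hq hqp hx))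
    · exact Or.inr (Or.inl ⟨rfl, x, rfl, hx, hpos⟩)
    · exact Or.inr (Or.inr ⟨inv_one, x⁻¹, map_inv _ _, by rw [map_inv, hx, inv_one], hneg⟩)

theorem zmod_prod_zmod {m n : ℕ} [NeZero m] [NeZero n] (h : m.Coprime n) :
    CircularlyOrderable (Multiplicative (ZMod m) × Multiplicative (ZMod n)) := by
  let e := (MulEquiv.prodMultiplicative (ZMod m) (ZMod n)).symm.trans
    (ZMod.chineseRemainder h).symm.toAddEquiv.toMultiplicative
  exact of_injective e.toMonoidHom e.injective (zmod (m * n))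

/-- If `G × A` is circularly-orderable, then so is `G × ℤ/n` for `n` the order of an element
of `A`. -/
theorem prod_zmod_orderOf {G A : Type*} [Group G] [Group A] (h : CircularlyOrderable (G × A))
    (a : A) : CircularlyOrderable (G × Multiplicative (ZMod (orderOf a))) := by
  rw [← Nat.card_zpowers]
  let φ := (Subgroup.zpowers a).subtype.comp
    (zmodCyclicMulEquiv (G := Subgroup.zpowers a) inferInstance).toMonoidHom
  exact of_injective ((MonoidHom.id G).prodMap φ) (Function.Injective.prodMap
    Function.injective_id (Subtype.val_injective.comp (MulEquiv.injective _))) h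

theorem not_zmod_prod_self {p : ℕ} (hp : p.Prime) :
    ¬ CircularlyOrderable (Multiplicative (ZMod p) × Multiplicative (ZMod p)) := by
  have : NeZero p := ⟨hp.ne_zero⟩
  intro h
  have : Finite (Multiplicative (ZMod p)) := inferInstanceAs (Finite (ZMod p))
  have h1 := (Group.isCyclic_prod_iff.1 h.isCyclic_of_finite).2.2
  rw [Nat.card_eq_fintype_card, Fintype.card_multiplicative, ZMod.card, Nat.coprime_self] at h1
  exact hp.ne_one h1

end CircularlyOrderable

theorem exists_mem_minOb_dvd {G : Type*} [Group G] {n : ℕ} (hn : n ∈ Ob G) :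
    ∃ m ∈ minOb G, m ∣ n := by
  induction n using Nat.strong_induction_on with
  | _ n ih =>
    by_cases h : ∀ m ∈ Ob G, m ∣ n → m = n
    · exact ⟨n, ⟨hn, h⟩, dvd_rfl⟩
    · push Not at h
      obtain ⟨m, hm, hmn, hne⟩ := h
      have hlt := lt_of_le_of_ne (Nat.le_of_dvd (by have := hn.1; omega) hmn) hne
      obtain ⟨k, hk, hkm⟩ := ih m hlt hm
      exact ⟨k, hk, hkm.trans hmn⟩

theorem Nat.Prime.mem_minOb {G : Type*} [Group G] {p : ℕ} (hp : p.Prime) (h : p ∈ Ob G) :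
    p ∈ minOb G :=
  ⟨h, fun m hm hmp => ((Nat.dvd_prime hp).1 hmp).resolve_left (by have := hm.1; omega)⟩

/-- For `A` with a bi-invariant circular ordering, the primes in `Ob(A)` are the prime orders of
elements of `A`. -/
theorem Nat.Prime.mem_ob_iff_exists_orderOf_eq {A : Type*} [Group A] {c : A → A → A → ℤ}
    (hc : IsBiInvariantCircularOrdering c) {p : ℕ} (hp : p.Prime) :
    p ∈ Ob A ↔ ∃ a : A, orderOf a = p := by
  constructor
  · rintro ⟨-, h⟩
    by_contra hno
    have : NeZero p := ⟨hp.ne_zero⟩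
    refine h (.of_injective (MulEquiv.prodComm : A × _ ≃* _ × A).toMonoidHom
      (MulEquiv.injective _) (.prod_of_isBiInvariant hc fun m hm hmp => ?_))
    have : NeZero m := ⟨hm⟩
    exact .zmod_prod_zmod ((Nat.Prime.coprime_iff_not_dvd hp).2 fun hpm => hno (hmp p hp hpm))
  · rintro ⟨a, rfl⟩
    refine ⟨hp.two_le, fun h => CircularlyOrderable.not_zmod_prod_self hp ?_⟩
    exact .prod_zmod_orderOf (.of_injective (MulEquiv.prodComm).toMonoidHom
      (MulEquiv.injective _) h) a

/-- Let `A` admit a bi-invariant circular ordering and let `G` be circularly-orderable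
with every minimal element of `Ob(G)` prime. Then `G × A` is circularly-orderable if
and only if `min(Ob(G)) ∩ min(Ob(A)) = ∅`. -/
theorem product_with_biInvariant_circularlyOrderable_iff {G A : Type*} [Group G] [Group A]
    (hA : ∃ c : A → A → A → ℤ, IsBiInvariantCircularOrdering c)
    (hG : CircularlyOrderable G)
    (hmin : ∀ n ∈ minOb G, Nat.Prime n) :
    CircularlyOrderable (G × A) ↔ minOb G ∩ minOb A = ∅ := by
  obtain ⟨c, hc⟩ := hA
  constructor
  · intro hGA
    rw [Set.eq_empty_iff_forall_notMem]
    rintro p ⟨hpG, hpA⟩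
    obtain ⟨a, rfl⟩ := ((hmin p hpG).mem_ob_iff_exists_orderOf_eq hc).1 hpA.1
    exact hpG.1.2 (hGA.prod_zmod_orderOf a)
  · intro hdisj
    refine .prod_of_isBiInvariant hc fun m hm0 hm => ?_
    by_contra hno
    have hm1 : m ≠ 1 := by
      rintro rfl
      refine hno (.of_injective (MonoidHom.fst G _) (fun x y hxy => Prod.ext hxy ?_) hG)
      exact Subsingleton.elim (α := ZMod 1) _ _
    obtain ⟨p, hpG, hpm⟩ := exists_mem_minOb_dvd (G := G) (n := m) ⟨by omega, hno⟩
    have hp := hmin p hpG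
    have hpA := hp.mem_minOb ((hp.mem_ob_iff_exists_orderOf_eq hc).2 (hm p hp hpm))
    exact Set.notMem_empty p (hdisj ▸ ⟨hpG, hpA⟩)
end

section
/- Let G and H be groups each admitting a bi-invariant circular ordering. Then G × H is circularly-orderable if and only if min(Ob(G)) ∩ min(Ob(H)) = ∅, where min denotes the set of minimal elements under divisibility. -/
section CircularOrder

variable {G : Type*} [Group G] {c : G → G → G → ℤ}

theorem IsHomCircularOrdering.swap (hc : IsHomCircularOrdering c) (x y w : G) :
    c x w y = -c x y w := by
  obtain ⟨-, h0, hco, -⟩ := hc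
  have h := hco x y w y
  have h1 : c y w y = 0 := (h0 _ _ _).2 (by simp)
  have h2 : c x y y = 0 := (h0 _ _ _).2 (by simp)
  omega

theorem CircularlyOrderable.of_injective_s17 {E F : Type*} [Group E] [Group F] (φ : E →* F)
    (hφ : Function.Injective φ) (hF : CircularlyOrderable F) : CircularlyOrderable E := by
  obtain ⟨c, h1, h2, h3, h4⟩ := hF
  refine ⟨fun x y w => c (φ x) (φ y) (φ w), fun _ _ _ => h1 _ _ _, fun x y w => ?_,
    fun _ _ _ _ => h3 _ _ _ _, fun _ _ _ _ => ?_⟩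
  · simp [h2, hφ.eq_iff]
  · simp [h4]

/-- In a finite circularly ordered group the successor of the identity is a generator. -/
theorem CircularlyOrderable.exists_generator {F : Type*} [Group F] [Finite F] [Nontrivial F]
    (hF : CircularlyOrderable F) : ∃ a : F, ∀ y, y ∈ Subgroup.zpowers a := by
  obtain ⟨c, hc⟩ := hF
  obtain ⟨hv, h0, hco, hinv⟩ := id hc
  have : IsTrans F (fun x y => c 1 x y = 1) := ⟨fun x y w h1 h2 => by
    have := hco 1 x y w
    have := hv x y w
    have := hv 1 x w
    omega⟩
  have : Std.Irrefl (fun x y : F => c 1 x y = 1) := ⟨fun x h => by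
    have : c 1 x x = 0 := (h0 _ _ _).2 (by simp)
    omega⟩
  have wf := Finite.wellFounded_of_trans_of_irrefl (fun x y : F => c 1 x y = 1)
  obtain ⟨a, ha, hmin⟩ := wf.has_min {a : F | a ≠ 1} (exists_ne 1)
  have hsucc : ∀ y, y ≠ 1 → y ≠ a → c 1 a y = 1 := by
    intro y h1 h2
    have h3 := hmin y h1
    have h4 := hc.swap 1 a y
    have h5 := hv 1 a y
    have h6 : c 1 a y ≠ 0 := by
      rw [Ne, h0]
      rintro (h | h | h)
      · exact ha h.symm
      · exact h1 h.symm
      · exact h2 h.symm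
    omega
  refine ⟨a, fun y => ?_⟩
  by_contra hy
  have hstep : ∀ k : ℕ, c (a ^ k) (a ^ (k + 1)) y = 1 := by
    intro k
    have h := hinv (a ^ k) 1 a ((a ^ k)⁻¹ * y)
    rw [mul_one, ← pow_succ, mul_inv_cancel_left] at h
    rw [h]
    refine hsucc _ (fun h => hy ?_) (fun h => hy ?_)
    · rw [inv_mul_eq_one] at h
      exact h ▸ Subgroup.npow_mem_zpowers a k
    · rw [inv_mul_eq_iff_eq_mul, ← pow_succ] at h
      exact h ▸ Subgroup.npow_mem_zpowers a (k + 1)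
  have hge : ∀ k : ℕ, 1 ≤ c 1 (a ^ (k + 1)) y := by
    intro k
    induction k with
    | zero => simpa using (hstep 0).ge
    | succ k ih =>
      have h1 := hco 1 (a ^ (k + 1)) (a ^ (k + 2)) y
      have h2 := hstep (k + 1)
      have h3 := hv 1 (a ^ (k + 1)) (a ^ (k + 2))
      simp only [add_assoc, Nat.reduceAdd] at *
      omega
  have h1 := hge (orderOf a - 1)
  rw [Nat.sub_add_cancel (orderOf_pos a), pow_orderOf_eq_one] at h1
  have h2 : c 1 1 y = 0 := (h0 _ _ _).2 (by simp)
  omega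

/-- A product of two groups with torsion of the same prime order is not circularly orderable. -/
theorem not_circularlyOrderable_prod {G H : Type*} [Group G] [Group H] {p : ℕ} (hp : p.Prime)
    {g : G} {h : H} (hg : orderOf g = p) (hh : orderOf h = p) :
    ¬ CircularlyOrderable (G × H) := by
  intro hGH
  have hF : CircularlyOrderable (Subgroup.zpowers g × Subgroup.zpowers h) :=
    hGH.of_injective_s17 ((Subgroup.zpowers g).subtype.prodMap (Subgroup.zpowers h).subtype)
      (Prod.map_injective.2 ⟨Subtype.val_injective, Subtype.val_injective⟩)
  have cg : Nat.card (Subgroup.zpowers g) = p := by rw [Nat.card_zpowers, hg]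
  have ch : Nat.card (Subgroup.zpowers h) = p := by rw [Nat.card_zpowers, hh]
  have : Finite (Subgroup.zpowers g) := Nat.finite_of_card_ne_zero (cg ▸ hp.ne_zero)
  have : Finite (Subgroup.zpowers h) := Nat.finite_of_card_ne_zero (ch ▸ hp.ne_zero)
  have : Nontrivial (Subgroup.zpowers g) :=
    Finite.one_lt_card_iff_nontrivial.1 (cg ▸ hp.one_lt)
  obtain ⟨a, ha⟩ := hF.exists_generator
  have h1 : orderOf a = p * p := by
    rw [orderOf_eq_card_of_forall_mem_zpowers ha, Nat.card_prod, cg, ch]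
  have h2 : a ^ p = 1 := by
    ext1
    · simpa [cg] using pow_card_eq_one' (x := a.1)
    · simpa [ch] using pow_card_eq_one' (x := a.2)
  have h3 := Nat.le_of_dvd hp.pos (orderOf_dvd_of_pow_eq_one h2)
  nlinarith [hp.one_lt]

end CircularOrder

section RotationData

/-- `r` represents a homomorphism to `ℝ / ℤ` that is injective on torsion, and `P` is the
nonnegative cone of a total left-invariant preorder whose indifference class of `1` is torsion. -/
structure IsRotationData {G : Type*} [Group G] (r : G → ℝ) (P : Set G) : Prop where
  map_mul : ∀ x y, ∃ k : ℤ, r (x * y) = r x + r y + k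
  mul_mem : ∀ x ∈ P, ∀ y ∈ P, x * y ∈ P
  total : ∀ x, x ∈ P ∨ x⁻¹ ∈ P
  isOfFinOrder : ∀ x ∈ P, x⁻¹ ∈ P → IsOfFinOrder x
  eq_one : ∀ x, IsOfFinOrder x → (∃ k : ℤ, r x = k) → x = 1

variable {G H : Type*} [Group G] [Group H] {r : G → ℝ} {P : Set G} {s : H → ℝ} {Q : Set H}

theorem IsRotationData.map_one (hr : IsRotationData r P) : ∃ k : ℤ, r 1 = k := by
  obtain ⟨k, hk⟩ := hr.map_mul 1 1
  refine ⟨-k, ?_⟩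
  rw [mul_one] at hk
  push_cast
  linarith

theorem IsRotationData.map_pow (hr : IsRotationData r P) (x : G) (n : ℕ) :
    ∃ k : ℤ, r (x ^ n) = n * r x + k := by
  induction n with
  | zero => simpa using hr.map_one
  | succ n ih =>
    obtain ⟨k, hk⟩ := ih
    obtain ⟨l, hl⟩ := hr.map_mul (x ^ n) x
    refine ⟨k + l, ?_⟩
    rw [pow_succ, hl, hk]
    push_cast
    ring

theorem IsRotationData.orderOf_mul (hr : IsRotationData r P) (x : G) :
    ∃ k : ℤ, orderOf x * r x = k := by
  obtain ⟨k, hk⟩ := hr.map_pow x (orderOf x)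
  obtain ⟨l, hl⟩ := hr.map_one
  rw [pow_orderOf_eq_one, hl] at hk
  exact ⟨l - k, by push_cast; linarith⟩

theorem exists_int_of_coprime {m n : ℕ} (h : m.Coprime n) {t : ℝ} (hm : ∃ k : ℤ, m * t = k)
    (hn : ∃ k : ℤ, n * t = k) : ∃ k : ℤ, t = k := by
  obtain ⟨k, hk⟩ := hm
  obtain ⟨l, hl⟩ := hn
  have hb := Nat.gcd_eq_gcd_ab m n
  rw [h.gcd_eq_one] at hb
  have hb' : (1 : ℝ) = m * (m.gcdA n : ℝ) + n * (m.gcdB n : ℝ) := by exact_mod_cast hb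
  refine ⟨k * m.gcdA n + l * m.gcdB n, ?_⟩
  push_cast
  rw [← hk, ← hl]
  linear_combination t * hb'

theorem coprime_orderOf {x : G} {y : H} (hx : IsOfFinOrder x) (hy : IsOfFinOrder y)
    (h : ∀ p : ℕ, p.Prime → ∀ (g : G) (h : H), orderOf g = p → orderOf h ≠ p) :
    (orderOf x).Coprime (orderOf y) := by
  refine Nat.Coprime.symm (Nat.coprime_of_dvd fun p hp hpx hpy => ?_)
  refine h p hp _ _ (orderOf_pow_orderOf_div hx.orderOf_pos.ne' ?_)
    (orderOf_pow_orderOf_div hy.orderOf_pos.ne' ?_) <;> assumption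

/-- Rotation data on groups without common prime torsion combine to rotation data on the product. -/
theorem IsRotationData.prod (hr : IsRotationData r P) (hs : IsRotationData s Q)
    (h : ∀ p : ℕ, p.Prime → ∀ (g : G) (h : H), orderOf g = p → orderOf h ≠ p) :
    IsRotationData (fun x : G × H => r x.1 + s x.2)
      {x | x.1 ∈ P ∧ (x.1⁻¹ ∈ P → x.2 ∈ Q)} where
  map_mul x y := by
    obtain ⟨k, hk⟩ := hr.map_mul x.1 y.1
    obtain ⟨l, hl⟩ := hs.map_mul x.2 y.2
    refine ⟨k + l, ?_⟩
    simp only [Prod.fst_mul, Prod.snd_mul, hk, hl]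
    push_cast
    ring
  mul_mem x hx y hy := by
    refine ⟨hr.mul_mem _ hx.1 _ hy.1, fun hxy => hs.mul_mem _ (hx.2 ?_) _ (hy.2 ?_)⟩
    · simpa using hr.mul_mem _ hy.1 _ hxy
    · simpa using hr.mul_mem _ hxy _ hx.1
  total x := by
    have h1 := hr.total x.1
    have h2 := hs.total x.2
    simp only [Set.mem_ofPred_eq, Prod.fst_inv, Prod.snd_inv, inv_inv]
    tauto
  isOfFinOrder x hx hx' := by
    simp only [Set.mem_ofPred_eq, Prod.fst_inv, Prod.snd_inv, inv_inv] at hx hx'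
    have h1 := hr.isOfFinOrder _ hx.1 hx'.1
    have h2 := hs.isOfFinOrder _ (hx.2 hx'.1) (hx'.2 hx.1)
    exact h1.prod_mk h2
  eq_one x hx hk := by
    obtain ⟨k, hk⟩ := hk
    have h1 : IsOfFinOrder x.1 := (MonoidHom.fst G H).isOfFinOrder hx
    have h2 : IsOfFinOrder x.2 := (MonoidHom.snd G H).isOfFinOrder hx
    have hcop := coprime_orderOf h1 h2 h
    have hx1 := hr.orderOf_mul x.1
    have hx2 : ∃ l : ℤ, orderOf x.2 * r x.1 = l := by
      obtain ⟨l, hl⟩ := hs.orderOf_mul x.2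
      refine ⟨orderOf x.2 * k - l, ?_⟩
      push_cast
      rw [← hl, ← hk]
      ring
    obtain ⟨m, hm⟩ := exists_int_of_coprime hcop hx1 hx2
    refine Prod.ext (hr.eq_one _ h1 ⟨m, hm⟩) (hs.eq_one _ h2 ⟨k - m, ?_⟩)
    push_cast
    linarith

theorem isRotationData_zmod (n : ℕ) [NeZero n] :
    IsRotationData (fun x : Multiplicative (ZMod n) => ((x.toAdd.val : ℝ) / n)) Set.univ where
  map_mul x y := by
    have hn : (n : ℝ) ≠ 0 := Nat.cast_ne_zero.2 (NeZero.ne n)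
    have h := Nat.mod_add_div (x.toAdd.val + y.toAdd.val) n
    rw [← ZMod.val_add] at h
    generalize (x.toAdd.val + y.toAdd.val) / n = d at h
    have h' : ((x.toAdd + y.toAdd).val : ℝ) + n * d = x.toAdd.val + y.toAdd.val := by
      exact_mod_cast h
    refine ⟨-d, ?_⟩
    rw [toAdd_mul]
    push_cast
    field_simp
    linarith
  mul_mem _ _ _ _ := trivial
  total _ := Or.inl trivial
  isOfFinOrder x _ _ := isOfFinOrder_of_finite x
  eq_one x _ hk := by
    obtain ⟨k, hk⟩ := hk
    have hn : (0 : ℝ) < n := Nat.cast_pos.2 (NeZero.pos n)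
    have hlt : (x.toAdd.val : ℝ) < n := Nat.cast_lt.2 (ZMod.val_lt _)
    have h1 : (0 : ℝ) ≤ k := hk ▸ by positivity
    have h2 : (k : ℝ) < 1 := hk ▸ (div_lt_one hn).2 hlt
    have h3 : k = 0 := by
      have : 0 ≤ k := by exact_mod_cast h1
      have : k < 1 := by exact_mod_cast h2
      omega
    rw [h3, Int.cast_zero, div_eq_zero_iff, or_iff_left hn.ne', Nat.cast_eq_zero,
      ZMod.val_eq_zero] at hk
    exact hk

/-- A strict total order on a group that every left translation preserves up to an integer
winding function induces a circular ordering. -/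
theorem circularlyOrderable_of_winding (lt : G → G → Prop) (hirr : ∀ x, ¬ lt x x)
    (htrans : ∀ x y w, lt x y → lt y w → lt x w) (htri : ∀ x y, x ≠ y → lt x y ∨ lt y x)
    (hwind : ∀ h : G, ∃ w : G → ℤ, ∀ x y, (w x = w y ∧ (lt (h * x) (h * y) ↔ lt x y)) ∨
      (w x = w y + 1 ∧ lt (h * x) (h * y) ∧ lt y x) ∨
      (w y = w x + 1 ∧ lt (h * y) (h * x) ∧ lt x y)) : CircularlyOrderable G := by
  classical
  set s : G → G → ℤ := fun x y => if x = y then 0 else if lt x y then 1 else -1 with hs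
  have hasymm : ∀ x y, lt x y → ¬ lt y x := fun x y h1 h2 => hirr x (htrans _ _ _ h1 h2)
  have hval : ∀ x y, (x = y ∧ s x y = 0) ∨ (x ≠ y ∧ lt x y ∧ s x y = 1) ∨
      (x ≠ y ∧ lt y x ∧ s x y = -1) := by
    intro x y
    have := htri x y
    have := hasymm x y
    by_cases hxy : x = y
    · simp [hs, hxy]
    · by_cases hl : lt x y
      · simp [hs, hxy, hl]
      · simp [hs, hxy, hl]
        tauto
  have hcyc : ∀ x y w, lt x y → lt y w → ¬ lt w x := fun x y w h1 h2 =>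
    hasymm x w (htrans _ _ _ h1 h2)
  have hshift : ∀ h : G, ∃ w : G → ℤ, ∀ x y, s (h * x) (h * y) = s x y + 2 * (w x - w y) := by
    intro h
    obtain ⟨w, hw⟩ := hwind h
    refine ⟨w, fun x y => ?_⟩
    rcases hw x y with ⟨h1, h2⟩ | ⟨h1, h2, h3⟩ | ⟨h1, h2, h3⟩
    · simp [hs, h1, h2]
    · have e1 : x ≠ y := fun e => hirr x (by rw [← e] at h3; exact h3)
      have e2 : ¬ lt x y := hasymm _ _ h3
      simp [hs, h1, h2, e1, e2]
    · have e1 : x ≠ y := fun e => hirr x (by rw [← e] at h3; exact h3)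
      have e2 : ¬ lt (h * x) (h * y) := hasymm _ _ h2
      simp [hs, h1, h3, e1, e2]
  refine ⟨fun x y w => s x y + s y w + s w x, fun x y w => ?_, fun x y w => ?_,
    fun x y w v => ?_, fun h x y w => ?_⟩
  · have := hcyc x y w
    have := hcyc y x w
    rcases hval x y with ⟨a, a'⟩ | ⟨a, b, a'⟩ | ⟨a, b, a'⟩ <;>
    rcases hval y w with ⟨d, d'⟩ | ⟨d, e, d'⟩ | ⟨d, e, d'⟩ <;>
    rcases hval w x with ⟨f, f'⟩ | ⟨f, g, f'⟩ | ⟨f, g, f'⟩ <;>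
    simp only [a', d', f'] <;> grind
  · have := hcyc x y w
    have := hcyc y x w
    rcases hval x y with ⟨a, a'⟩ | ⟨a, b, a'⟩ | ⟨a, b, a'⟩ <;>
    rcases hval y w with ⟨d, d'⟩ | ⟨d, e, d'⟩ | ⟨d, e, d'⟩ <;>
    rcases hval w x with ⟨f, f'⟩ | ⟨f, g, f'⟩ | ⟨f, g, f'⟩ <;>
    simp only [a', d', f'] <;> grind
  · have hanti : ∀ a b, s a b = -s b a := by
      intro a b
      have := hasymm a b
      rcases hval a b with ⟨d, d'⟩ | ⟨d, e, d'⟩ | ⟨d, e, d'⟩ <;>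
      rcases hval b a with ⟨f, f'⟩ | ⟨f, g, f'⟩ | ⟨f, g, f'⟩ <;> grind
    have h1 := hanti x y
    have h2 := hanti y w
    have h3 := hanti x w
    have h4 := hanti x v
    have h5 := hanti y v
    have h6 := hanti w v
    simp only
    omega
  · obtain ⟨m, hm⟩ := hshift h
    simp only [hm]
    ring

theorem IsRotationData.circularlyOrderable (hr : IsRotationData r P) : CircularlyOrderable G := by
  refine circularlyOrderable_of_winding (fun x y => Int.fract (r x) < Int.fract (r y) ∨
    (Int.fract (r x) = Int.fract (r y) ∧ x ≠ y ∧ x⁻¹ * y ∈ P)) ?_ ?_ ?_ ?_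
  · simp
  · have hne : ∀ x y : G, Int.fract (r x) = Int.fract (r y) → x⁻¹ * y ∈ P → y⁻¹ * x ∈ P →
        x = y := by
      intro x y hxy h1 h2
      have h3 := hr.isOfFinOrder _ h1 (by simpa using h2)
      obtain ⟨k, hk⟩ := hr.map_mul x (x⁻¹ * y)
      obtain ⟨l, hl⟩ := Int.fract_eq_fract.1 hxy
      rw [mul_inv_cancel_left] at hk
      have := hr.eq_one _ h3 ⟨-l - k, by push_cast; linarith⟩
      exact inv_mul_eq_one.1 this
    rintro x y w (h1 | ⟨h1, h1', h1''⟩) (h2 | ⟨h2, h2', h2''⟩)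
    · exact Or.inl (h1.trans h2)
    · exact Or.inl (h2 ▸ h1)
    · exact Or.inl (h1 ▸ h2)
    · have h3 : x⁻¹ * w ∈ P := by
        simpa [mul_assoc] using hr.mul_mem _ h1'' _ h2''
      refine Or.inr ⟨h1.trans h2, ?_, h3⟩
      rintro rfl
      exact h1' (hne _ _ h1 h1'' h2'')
  · intro x y hxy
    have := hr.total (x⁻¹ * y)
    rw [mul_inv_rev, inv_inv] at this
    rcases lt_trichotomy (Int.fract (r x)) (Int.fract (r y)) with h | h | h
    · exact Or.inl (Or.inl h)
    · rcases this with h' | h'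
      · exact Or.inl (Or.inr ⟨h, hxy, h'⟩)
      · exact Or.inr (Or.inr ⟨h.symm, hxy.symm, h'⟩)
    · exact Or.inr (Or.inl h)
  · intro h
    have hw : ∀ x, ∃ w : ℤ, Int.fract (r (h * x)) = Int.fract (r h) + Int.fract (r x) - w := by
      intro x
      obtain ⟨k, hk⟩ := hr.map_mul h x
      refine ⟨⌊r (h * x)⌋ - ⌊r h⌋ - ⌊r x⌋ - k, ?_⟩
      simp only [Int.fract]
      push_cast
      linarith
    choose w hw using hw
    refine ⟨w, fun x y => ?_⟩
    have b1 := Int.fract_nonneg (r h)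
    have b2 := Int.fract_nonneg (r x)
    have b3 := Int.fract_nonneg (r y)
    have b4 := Int.fract_nonneg (r (h * x))
    have b5 := Int.fract_nonneg (r (h * y))
    have c1 := Int.fract_lt_one (r h)
    have c2 := Int.fract_lt_one (r x)
    have c3 := Int.fract_lt_one (r y)
    have c4 := Int.fract_lt_one (r (h * x))
    have c5 := Int.fract_lt_one (r (h * y))
    have hx := hw x
    have hy := hw y
    have range : ∀ m : ℤ, (m : ℝ) < 2 → (-1 : ℝ) < m → m = 0 ∨ m = 1 := by
      intro m h1 h2
      have : m < 2 := by exact_mod_cast h1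
      have : -1 < m := by exact_mod_cast h2
      omega
    have hcases : ∀ a b : G, w a = 1 → w b = 0 →
        Int.fract (r (h * a)) < Int.fract (r (h * b)) ∧ Int.fract (r b) < Int.fract (r a) := by
      intro a b ha hb
      have h1 := hw a
      have h2 := hw b
      have := Int.fract_lt_one (r a)
      have := Int.fract_nonneg (r b)
      have := Int.fract_nonneg (r (h * a))
      have := Int.fract_lt_one (r (h * b))
      rw [ha, Int.cast_one] at h1
      rw [hb, Int.cast_zero] at h2
      constructor <;> linarith
    rcases range (w x) (by linarith) (by linarith) with ex | ex <;>
    rcases range (w y) (by linarith) (by linarith) with ey | ey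
    · left
      simp [ex, ey, hx, hy, mul_assoc]
    · right; right
      obtain ⟨h1, h2⟩ := hcases y x ey ex
      exact ⟨by omega, Or.inl h1, Or.inl h2⟩
    · right; left
      obtain ⟨h1, h2⟩ := hcases x y ex ey
      exact ⟨by omega, Or.inl h1, Or.inl h2⟩
    · left
      simp [ex, ey, hx, hy, mul_assoc]

end RotationData

section OrderedGroup

theorem exists_rat_linear_retraction : ∃ ρ : ℝ →ₗ[ℚ] ℚ, ∀ q : ℚ, ρ q = q := by
  obtain ⟨ρ, hρ⟩ := (Algebra.linearMap ℚ ℝ).exists_leftInverse_of_injective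
    (LinearMap.ker_eq_bot.2 (algebraMap ℚ ℝ).injective)
  exact ⟨ρ, fun q => by simpa using LinearMap.congr_fun hρ q⟩

theorem strictMono_zpow_of_one_lt {Γ : Type*} [Group Γ] [LinearOrder Γ] [MulLeftMono Γ]
    {z : Γ} (hz : 1 < z) : StrictMono fun n : ℤ => z ^ n :=
  strictMono_int_of_lt_succ fun n => by
    rw [zpow_add_one]
    exact lt_mul_of_one_lt_right' _ hz

variable {Γ : Type*} [Group Γ] [LinearOrder Γ] [MulLeftMono Γ] [MulRightMono Γ]

theorem mul_pow_between {x y : Γ} (h : x * y ≤ y * x) (n : ℕ) :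
    x ^ n * y ^ n ≤ (x * y) ^ n ∧ (y * x) ^ n ≤ y ^ n * x ^ n := by
  have hpow : ∀ n, (x * y) ^ n ≤ (y * x) ^ n := fun n => pow_le_pow_left' h n
  have hxy : ∀ n, (x * y) ^ (n + 1) = x * (y * x) ^ n * y := by
    intro n
    induction n with
    | zero => simp
    | succ n ih => rw [pow_succ, ih, pow_succ]; simp only [mul_assoc]
  have hyx : ∀ n, (y * x) ^ (n + 1) = y * (x * y) ^ n * x := by
    intro n
    induction n with
    | zero => simp
    | succ n ih => rw [pow_succ, ih, pow_succ]; simp only [mul_assoc]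
  constructor
  · induction n with
    | zero => simp
    | succ n ih =>
      calc x ^ (n + 1) * y ^ (n + 1) = x * (x ^ n * y ^ n) * y := by
            rw [pow_succ', pow_succ]; simp only [mul_assoc]
        _ ≤ x * (y * x) ^ n * y := by gcongr; exact ih.trans (hpow n)
        _ = (x * y) ^ (n + 1) := (hxy n).symm
  · induction n with
    | zero => simp
    | succ n ih =>
      calc (y * x) ^ (n + 1) = y * (x * y) ^ n * x := hyx n
        _ ≤ y * (y ^ n * x ^ n) * x := by gcongr; exact (hpow n).trans ih
        _ = y ^ (n + 1) * x ^ (n + 1) := by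
            rw [pow_succ', pow_succ]; simp only [mul_assoc]

theorem mul_pow_mem_Icc {x y a b : Γ} {n : ℕ} (h1 : x ^ n * y ^ n ∈ Set.Icc a b)
    (h2 : y ^ n * x ^ n ∈ Set.Icc a b) : (x * y) ^ n ∈ Set.Icc a b := by
  rcases le_total (x * y) (y * x) with h | h
  · obtain ⟨h3, h4⟩ := mul_pow_between h n
    exact ⟨h1.1.trans h3, ((pow_le_pow_left' h n).trans h4).trans h2.2⟩
  · obtain ⟨h3, h4⟩ := mul_pow_between h n
    exact ⟨(h2.1.trans h3).trans (pow_le_pow_left' h n), h4.trans h1.2⟩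

theorem zpow_mul_le_pow_mul {z x : Γ} {p : ℤ} {q : ℕ} (h : z ^ p ≤ x ^ q) (n : ℕ) :
    z ^ (p * n) ≤ x ^ (q * n) := by
  rw [zpow_mul, zpow_natCast, pow_mul]
  exact pow_le_pow_left' h n

theorem pow_mul_le_zpow_mul {z x : Γ} {p : ℤ} {q : ℕ} (h : x ^ q ≤ z ^ p) (n : ℕ) :
    x ^ (q * n) ≤ z ^ (p * n) := by
  rw [zpow_mul, zpow_natCast, pow_mul]
  exact pow_le_pow_left' h n

/-- The translation number of `x` relative to `z`. -/
noncomputable def translationNumber (z x : Γ) : ℝ :=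
  sSup {t : ℝ | ∃ (p : ℤ) (q : ℕ), 0 < q ∧ z ^ p ≤ x ^ q ∧ t = p / q}

variable {z : Γ}

theorem div_le_div_of_zpow_le_pow (hz : 1 < z) {x : Γ} {p r : ℤ} {q s : ℕ} (hq : 0 < q)
    (hs : 0 < s) (h1 : z ^ p ≤ x ^ q) (h2 : x ^ s ≤ z ^ r) : (p / q : ℝ) ≤ r / s := by
  have h3 := zpow_mul_le_pow_mul h1 s
  have h4 := pow_mul_le_zpow_mul h2 q
  rw [mul_comm s q] at h4
  have h5 := (strictMono_zpow_of_one_lt hz).le_iff_le.1 (h3.trans h4)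
  rw [div_le_div_iff₀ (by positivity) (by positivity)]
  exact_mod_cast h5

theorem div_le_translationNumber (hz : 1 < z)
    (hfloor : ∀ x : Γ, ∃ k : ℤ, z ^ k ≤ x ∧ x ≤ z ^ (k + 1)) {x : Γ} {p : ℤ} {q : ℕ} (hq : 0 < q) (h : z ^ p ≤ x ^ q) :
    (p / q : ℝ) ≤ translationNumber z x := by
  refine le_csSup ?_ ⟨p, q, hq, h, rfl⟩
  obtain ⟨k, -, hk⟩ := hfloor x
  refine ⟨((k + 1 : ℤ) : ℝ) / (1 : ℕ), ?_⟩
  rintro t ⟨p', q', hq', h', rfl⟩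
  exact div_le_div_of_zpow_le_pow hz hq' one_pos h' (by simpa using hk)

theorem translationNumber_le_div (hz : 1 < z)
    (hfloor : ∀ x : Γ, ∃ k : ℤ, z ^ k ≤ x ∧ x ≤ z ^ (k + 1)) {x : Γ} {p : ℤ} {q : ℕ} (hq : 0 < q) (h : x ^ q ≤ z ^ p) :
    translationNumber z x ≤ p / q := by
  refine csSup_le ?_ ?_
  · obtain ⟨k, hk, -⟩ := hfloor x
    exact ⟨_, k, 1, one_pos, by simpa using hk, rfl⟩
  · rintro t ⟨p', q', hq', h', rfl⟩
    exact div_le_div_of_zpow_le_pow hz hq' hq h' h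

theorem translationNumber_zpow (hz : 1 < z)
    (hfloor : ∀ x : Γ, ∃ k : ℤ, z ^ k ≤ x ∧ x ≤ z ^ (k + 1)) (k : ℤ) : translationNumber z (z ^ k) = k := by
  refine le_antisymm ?_ ?_
  · simpa using translationNumber_le_div hz hfloor (x := z ^ k) (p := k) one_pos (by simp)
  · simpa using div_le_translationNumber hz hfloor (x := z ^ k) (p := k) one_pos (by simp)

theorem translationNumber_mul (hz : 1 < z)
    (hfloor : ∀ x : Γ, ∃ k : ℤ, z ^ k ≤ x ∧ x ≤ z ^ (k + 1)) (x y : Γ) :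
    translationNumber z (x * y) = translationNumber z x + translationNumber z y := by
  have key : ∀ n : ℕ,
      |translationNumber z (x * y) - (translationNumber z x + translationNumber z y)|
        ≤ 2 * (1 / ((n : ℝ) + 1)) := by
    intro n
    have hq : 0 < n + 1 := n.succ_pos
    obtain ⟨p, hp, hp'⟩ := hfloor (x ^ (n + 1))
    obtain ⟨r, hr, hr'⟩ := hfloor (y ^ (n + 1))
    have hxy := mul_pow_mem_Icc (x := x) (y := y) (n := n + 1) (a := z ^ (p + r))
      (b := z ^ (p + r + 2))
      ⟨by rw [zpow_add]; exact mul_le_mul' hp hr,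
        by rw [show p + r + 2 = (p + 1) + (r + 1) by ring, zpow_add]; exact mul_le_mul' hp' hr'⟩
      ⟨by rw [add_comm, zpow_add]; exact mul_le_mul' hr hp,
        by rw [show p + r + 2 = (r + 1) + (p + 1) by ring, zpow_add]; exact mul_le_mul' hr' hp'⟩
    have a1 := div_le_translationNumber hz hfloor hq hp
    have a2 := translationNumber_le_div hz hfloor hq hp'
    have a3 := div_le_translationNumber hz hfloor hq hr
    have a4 := translationNumber_le_div hz hfloor hq hr'
    have a5 := div_le_translationNumber hz hfloor hq hxy.1
    have a6 := translationNumber_le_div hz hfloor hq hxy.2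
    push_cast [add_div] at a1 a2 a3 a4 a5 a6
    have a7 : (2 : ℝ) / ((n : ℝ) + 1) = 2 * (1 / ((n : ℝ) + 1)) := by ring
    rw [abs_le]
    constructor <;> linarith
  refine sub_eq_zero.1 (abs_eq_zero.1 (le_antisymm ?_ (abs_nonneg _)))
  have hlim := (tendsto_one_div_add_atTop_nhds_zero_nat (𝕜 := ℝ)).const_mul 2
  rw [mul_zero] at hlim
  exact ge_of_tendsto' hlim key

theorem translationNumber_inv (hz : 1 < z)
    (hfloor : ∀ x : Γ, ∃ k : ℤ, z ^ k ≤ x ∧ x ≤ z ^ (k + 1)) (x : Γ) : translationNumber z x⁻¹ = -translationNumber z x := by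
  have h1 := translationNumber_mul hz hfloor x x⁻¹
  have h2 := translationNumber_zpow hz hfloor 0
  rw [zpow_zero] at h2
  rw [mul_inv_cancel, h2, Int.cast_zero] at h1
  linarith

/-- A total left-invariant preorder on `Γ`, given by its nonnegative cone, in which `1` is
indifferent only to the roots of powers of `z`. -/
theorem exists_cone (hz : 1 < z)
    (hfloor : ∀ x : Γ, ∃ k : ℤ, z ^ k ≤ x ∧ x ≤ z ^ (k + 1)) :
    ∃ P : Set Γ, (∀ x ∈ P, ∀ y ∈ P, x * y ∈ P) ∧ (∀ x, x ∈ P ∨ x⁻¹ ∈ P) ∧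
    (∀ k : ℤ, z ^ k ∈ P) ∧
    ∀ x ∈ P, x⁻¹ ∈ P → ∃ (N : ℕ) (M : ℤ), 0 < N ∧ x ^ N = z ^ M := by
  obtain ⟨ρ, hρ⟩ := exists_rat_linear_retraction
  set τ := translationNumber z with hτ
  have hmul : ∀ x y, τ (x * y) = τ x + τ y := translationNumber_mul hz hfloor
  have hinv : ∀ x, τ x⁻¹ = -τ x := translationNumber_inv hz hfloor
  have hrat : ∀ (p : ℤ) (q : ℕ), (ρ ((p : ℝ) / q) : ℝ) = (p : ℝ) / q := by
    intro p q
    have := hρ ((p : ℚ) / q)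
    push_cast at this
    rw [this]
    push_cast
    rfl
  refine ⟨{x | (ρ (τ x) : ℝ) < τ x ∨ ∃ (p : ℤ) (q : ℕ), 0 < q ∧ τ x = p / q ∧ z ^ p ≤ x ^ q},
    ?_, ?_, ?_, ?_⟩
  · rintro x (hx | ⟨p, q, hq, hx, hx'⟩) y (hy | ⟨r, s, hs, hy, hy'⟩)
    · left
      rw [hmul, map_add]
      push_cast
      linarith
    · left
      have := hrat r s
      rw [hmul, map_add, hy]
      push_cast
      linarith
    · left
      have := hrat p q
      rw [hmul, map_add, hx]
      push_cast
      linarith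
    · right
      refine ⟨p * s + r * q, q * s, by positivity, ?_, ?_⟩
      · rw [hmul, hx, hy]
        push_cast
        field_simp
      · have h1 := zpow_mul_le_pow_mul hx' s
        have h2 := zpow_mul_le_pow_mul hy' q
        rw [mul_comm s q] at h2
        refine (mul_pow_mem_Icc (b := max (x ^ (q * s) * y ^ (q * s)) (y ^ (q * s) * x ^ (q * s)))
          ⟨?_, le_max_left _ _⟩ ⟨?_, le_max_right _ _⟩).1
        · rw [zpow_add]
          exact mul_le_mul' h1 h2
        · rw [add_comm, zpow_add]
          exact mul_le_mul' h2 h1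
  · intro x
    rcases lt_trichotomy (ρ (τ x) : ℝ) (τ x) with h | h | h
    · exact Or.inl (Or.inl h)
    · have hx : τ x = ((ρ (τ x)).num : ℝ) / ((ρ (τ x)).den : ℕ) := by
        rw [← Rat.cast_def, h]
      rcases le_total (z ^ (ρ (τ x)).num) (x ^ (ρ (τ x)).den) with h' | h'
      · exact Or.inl (Or.inr ⟨_, _, (ρ (τ x)).den_pos, hx, h'⟩)
      · refine Or.inr (Or.inr ⟨-(ρ (τ x)).num, (ρ (τ x)).den, (ρ (τ x)).den_pos, ?_, ?_⟩)
        · rw [hinv]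
          push_cast
          rw [neg_div, ← hx]
        · rw [zpow_neg, inv_pow]
          exact inv_le_inv_iff.2 h'
    · refine Or.inr (Or.inl ?_)
      rw [hinv, map_neg]
      push_cast
      linarith
  · intro k
    exact Or.inr ⟨k, 1, one_pos, by simpa using translationNumber_zpow hz hfloor k, by simp⟩
  · rintro x (hx | ⟨p, q, hq, hx, hx'⟩) (hy | ⟨r, s, hs, hy, hy'⟩)
    · rw [hinv, map_neg] at hy
      push_cast at hy
      linarith
    · have h1 := hrat (-r) s
      have h2 : τ x = ((-r : ℤ) : ℝ) / s := by
        rw [hinv] at hy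
        push_cast
        rw [neg_div]
        linarith
      rw [← h2] at h1
      linarith
    · rw [hinv, map_neg, hx] at hy
      have := hrat p q
      push_cast at hy
      linarith
    · refine ⟨q * s, p * s, by positivity, le_antisymm ?_ (zpow_mul_le_pow_mul hx' s)⟩
      have h1 := zpow_mul_le_pow_mul hy' q
      have h2 : -(r * q) = p * s := by
        rw [hinv, hx] at hy
        field_simp at hy
        have : -(p * s) = r * q := by exact_mod_cast (by linarith : -((p : ℝ) * s) = r * q)
        linarith
      rw [inv_pow] at h1
      rw [← h2, zpow_neg, mul_comm q s]
      exact le_inv_of_le_inv h1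

/-- Rotation data descend from a bi-ordered group along a quotient by a cofinal cyclic subgroup. -/
theorem exists_isRotationData {G : Type*} [Group G] (hz : 1 < z)
    (hfloor : ∀ x : Γ, ∃ k : ℤ, z ^ k ≤ x ∧ x ≤ z ^ (k + 1)) (π : Γ →* G) (hπ : Function.Surjective π)
    (hker : ∀ x, π x = 1 ↔ ∃ k : ℤ, x = z ^ k) : ∃ r P, IsRotationData (G := G) r P := by
  obtain ⟨P, hP1, hP2, hP3, hP4⟩ := exists_cone hz hfloor
  have hτ := translationNumber_mul hz hfloor
  obtain ⟨σ, hσ⟩ := hπ.hasRightInverse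
  refine ⟨fun g => translationNumber z (σ g), π '' P, ?_, ?_, ?_, ?_, ?_⟩
  · intro g h
    obtain ⟨k, hk⟩ := (hker ((σ g * σ h)⁻¹ * σ (g * h))).1 (by simp [hσ _])
    refine ⟨k, ?_⟩
    rw [inv_mul_eq_iff_eq_mul] at hk
    simp only [hk, hτ, translationNumber_zpow hz hfloor]
  · rintro _ ⟨x, hx, rfl⟩ _ ⟨y, hy, rfl⟩
    exact ⟨x * y, hP1 x hx y hy, map_mul _ _ _⟩
  · intro g
    obtain ⟨x, rfl⟩ := hπ g
    exact (hP2 x).imp (fun h => ⟨x, h, rfl⟩) fun h => ⟨x⁻¹, h, map_inv _ _⟩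
  · rintro _ ⟨x, hx, rfl⟩ ⟨y, hy, hxy⟩
    obtain ⟨k, hk⟩ := (hker (x * y)).1 (by simp [hxy])
    have hx' : x⁻¹ ∈ P := by
      have h := hP1 y hy _ (hP3 (-k))
      rwa [zpow_neg, ← hk, mul_inv_rev, mul_inv_cancel_left] at h
    obtain ⟨N, M, hN, hNM⟩ := hP4 x hx hx'
    exact isOfFinOrder_iff_pow_eq_one.2 ⟨N, hN, by rw [← map_pow]; exact (hker _).2 ⟨M, hNM⟩⟩
  · rintro g hg ⟨k, hk⟩
    obtain ⟨n, hn, hgn⟩ := isOfFinOrder_iff_pow_eq_one.1 hg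
    obtain ⟨m, hm⟩ := (hker (σ g ^ n)).1 (by rw [map_pow, hσ, hgn])
    have h1 := div_le_translationNumber hz hfloor hn hm.ge
    have h2 := translationNumber_le_div hz hfloor hn hm.le
    rw [hk] at h1 h2
    have h3 : m = k * n := by
      have : (m : ℝ) = k * n := by
        rw [← div_eq_iff (by positivity)]
        exact le_antisymm h1 h2
      exact_mod_cast this
    have h4 : σ g ^ n = (z ^ k) ^ n := by rw [hm, h3, zpow_mul, zpow_natCast]
    have h5 : σ g = z ^ k := (pow_left_strictMono hn.ne').injective h4
    rw [← hσ g]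
    exact (hker _).2 ⟨k, h5⟩

end OrderedGroup

section CentralExtension

/-- A normalized `{0, 1}`-valued `2`-cocycle, compatible with inversion and conjugation: the data
describing a bi-ordered central extension by `ℤ` with cofinal centre. -/
structure OrderCocycle (G : Type*) [Group G] where
  /-- The underlying function. -/
  toFun : G → G → ℤ
  nonneg : ∀ g h, 0 ≤ toFun g h
  le_one : ∀ g h, toFun g h ≤ 1
  one_left : ∀ g, toFun 1 g = 0
  one_right : ∀ g, toFun g 1 = 0
  inv_right : ∀ g, g ≠ 1 → toFun g g⁻¹ = 1
  cocycle : ∀ g h k, toFun g h + toFun (g * h) k = toFun h k + toFun g (h * k)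
  conj : ∀ g h, toFun h g = toFun (h * g * h⁻¹) h

variable {G : Type*} [Group G]

/-- The central extension of `G` by `ℤ` defined by an order cocycle. -/
@[ext]
structure OrderCocycle.Extension (f : OrderCocycle G) where
  /-- The central coordinate. -/
  height : ℤ
  /-- The image in `G`. -/
  base : G

namespace OrderCocycle

variable {f : OrderCocycle G}

namespace Extension

instance : Mul f.Extension := ⟨fun x y => ⟨x.height + y.height + f.toFun x.base y.base,
  x.base * y.base⟩⟩
instance : One f.Extension := ⟨⟨0, 1⟩⟩
instance : Inv f.Extension := ⟨fun x => ⟨-x.height - f.toFun x.base⁻¹ x.base, x.base⁻¹⟩⟩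

theorem mul_height (x y : f.Extension) :
    (x * y).height = x.height + y.height + f.toFun x.base y.base := rfl
theorem mul_base (x y : f.Extension) : (x * y).base = x.base * y.base := rfl
theorem one_height : (1 : f.Extension).height = 0 := rfl
theorem one_base : (1 : f.Extension).base = 1 := rfl
theorem inv_height (x : f.Extension) : x⁻¹.height = -x.height - f.toFun x.base⁻¹ x.base := rfl
theorem inv_base (x : f.Extension) : x⁻¹.base = x.base⁻¹ := rfl

instance : Group f.Extension := Group.ofLeftAxioms
  (fun x y w => by
    ext1
    · have := f.cocycle x.base y.base w.base
      simp only [mul_height, mul_base]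
      omega
    · simp only [mul_base, mul_assoc])
  (fun x => by ext1 <;> simp [mul_height, mul_base, one_height, one_base, f.one_left])
  (fun x => by
    ext1
    · simp only [mul_height, one_height, inv_height, inv_base]
      ring
    · simp only [mul_base, one_base, inv_base, inv_mul_cancel])

theorem height_nonneg_or (x : f.Extension) : 0 ≤ x.height ∨ 0 ≤ x⁻¹.height := by
  by_cases hx : x.base = 1
  · simp only [inv_height, hx, inv_one, f.one_left]
    omega
  · have := f.inv_right x.base⁻¹ (inv_ne_one.2 hx)
    rw [inv_inv] at this
    rw [inv_height, this]
    omega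

theorem eq_one_of_height_nonneg {x : f.Extension} (h1 : 0 ≤ x.height) (h2 : 0 ≤ x⁻¹.height) :
    x = 1 := by
  by_cases hx : x.base = 1
  · simp only [inv_height, hx, inv_one, f.one_left] at h2
    ext1
    · rw [one_height]
      omega
    · exact hx
  · have := f.inv_right x.base⁻¹ (inv_ne_one.2 hx)
    rw [inv_inv] at this
    rw [inv_height, this] at h2
    omega

theorem height_mul_nonneg {x y : f.Extension} (h1 : 0 ≤ x.height) (h2 : 0 ≤ y.height) :
    0 ≤ (x * y).height := by
  have := f.nonneg x.base y.base
  rw [mul_height]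
  omega

theorem height_conj (x y : f.Extension) : (y * x * y⁻¹).height = x.height := by
  have h1 : (y * x * y⁻¹ * y).height = (y * x).height := by rw [inv_mul_cancel_right]
  have h2 := f.conj x.base y.base
  rw [mul_height, mul_height y x] at h1
  simp only [mul_base, inv_base] at h1
  omega

noncomputable instance : LinearOrder f.Extension :=
  { le := fun x y => 0 ≤ (x⁻¹ * y).height
    le_refl := fun x => by simp [one_height]
    le_trans := fun x y w h1 h2 => by simpa [mul_assoc] using height_mul_nonneg h1 h2
    le_antisymm := fun x y h1 h2 =>
      inv_mul_eq_one.1 (eq_one_of_height_nonneg h1 (by simpa using h2))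
    le_total := fun x y => by simpa using height_nonneg_or (x⁻¹ * y)
    toDecidableLE := Classical.decRel _ }

theorem le_iff {x y : f.Extension} : x ≤ y ↔ 0 ≤ (x⁻¹ * y).height := Iff.rfl

instance : MulLeftMono f.Extension := ⟨fun a x y h => by
  rw [le_iff] at h ⊢
  simpa [mul_assoc] using h⟩

instance : MulRightMono f.Extension := ⟨fun a x y h => by
  rw [le_iff] at h ⊢
  have := height_conj (x⁻¹ * y) a⁻¹
  simp only [Function.swap, mul_inv_rev, inv_inv, mul_assoc] at this ⊢ h
  omega⟩

theorem zpow_height_base (k : ℤ) : (⟨1, 1⟩ : f.Extension) ^ k = ⟨k, 1⟩ := by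
  have hstep : ∀ k : ℤ, (⟨k, 1⟩ : f.Extension) * ⟨1, 1⟩ = ⟨k + 1, 1⟩ := fun k => by
    ext1 <;> simp [mul_height, mul_base, f.one_left]
  induction k with
  | zero => rfl
  | succ n ih => rw [zpow_add_one, ih, hstep]
  | pred n ih => rw [zpow_sub_one, ih, mul_inv_eq_iff_eq_mul, hstep, sub_add_cancel]

/-- The projection to `G`. -/
def proj : f.Extension →* G where
  toFun := base
  map_one' := rfl
  map_mul' _ _ := rfl

end Extension

theorem exists_isRotationData (f : OrderCocycle G) : ∃ r P, IsRotationData (G := G) r P := by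
  refine _root_.exists_isRotationData (Γ := f.Extension) (z := ⟨1, 1⟩) ?_ (fun x => ?_)
    Extension.proj (fun g => ⟨⟨0, g⟩, rfl⟩) (fun x => ?_)
  · refine lt_of_le_of_ne (by simp [Extension.le_iff]) fun h => ?_
    have := congrArg Extension.height h
    simp [Extension.one_height] at this
  · refine ⟨x.height, ?_, ?_⟩
    · rw [Extension.le_iff, ← zpow_neg, Extension.zpow_height_base, Extension.mul_height,
        f.one_left]
      simp
    · have := f.le_one x.base⁻¹ x.base
      rw [Extension.le_iff, Extension.zpow_height_base, Extension.mul_height, f.one_right,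
        Extension.inv_height]
      simp only
      omega
  · constructor
    · intro hx
      exact ⟨x.height, by rw [Extension.zpow_height_base]; exact Extension.ext rfl hx⟩
    · rintro ⟨k, rfl⟩
      rw [Extension.zpow_height_base]
      rfl

end OrderCocycle

end CentralExtension

section BiInvariant

variable {G : Type*} [Group G] {c : G → G → G → ℤ}

/-- For fixed `h` the difference is a bounded homomorphism of `g`, hence zero. -/
theorem IsBiInvariantCircularOrdering.left_eq_right (hc : IsBiInvariantCircularOrdering c)
    (g h : G) : c 1 g (g * h) = c 1 h (g * h) := by
  obtain ⟨⟨hv, h0, hco, hl⟩, hr⟩ := hc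
  have hadd : ∀ x y, c 1 (x * y) (x * y * h) - c 1 h (x * y * h) =
      (c 1 x (x * h) - c 1 h (x * h)) + (c 1 y (y * h) - c 1 h (y * h)) := by
    intro x y
    have e1 := hl x 1 y (y * h)
    have e2 := hl x 1 h (y * h)
    have e3 := hr h 1 x (x * y)
    rw [mul_one, ← mul_assoc] at e1 e2
    rw [one_mul] at e3
    have e4 := hco 1 x (x * y) (x * y * h)
    have e5 := hco 1 x (x * h) (x * y * h)
    have e6 := hco 1 h (x * h) (x * y * h)
    omega
  have hpow : ∀ n : ℕ, c 1 (g ^ n) (g ^ n * h) - c 1 h (g ^ n * h) =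
      n * (c 1 g (g * h) - c 1 h (g * h)) := by
    intro n
    induction n with
    | zero =>
      have a1 : c 1 1 h = 0 := (h0 _ _ _).2 (by simp)
      have a2 : c 1 h h = 0 := (h0 _ _ _).2 (by simp)
      simp [a1, a2]
    | succ n ih =>
      rw [pow_succ, hadd, ih]
      push_cast
      ring
  have := hpow 3
  have := hv 1 (g ^ 3) (g ^ 3 * h)
  have := hv 1 h (g ^ 3 * h)
  push_cast at *
  omega

open Classical in
/-- The order cocycle of a bi-invariant circular ordering. -/
noncomputable def IsBiInvariantCircularOrdering.orderCocycle
    (hc : IsBiInvariantCircularOrdering c) : OrderCocycle G := by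
  let f : G → G → ℤ := fun g h => if c 1 g (g * h) = -1 ∨ (g ≠ 1 ∧ g * h = 1) then 1 else 0
  let e : G → ℤ := fun g => if g = 1 then 0 else 1
  have hf : ∀ g h, 2 * f g h = e g + e h - e (g * h) - c 1 g (g * h) := by
    intro g h
    have hz := hc.1.2.1 1 g (g * h)
    have hv := hc.1.1 1 g (g * h)
    by_cases hg : g = 1
    · subst hg
      simp [f, e] at *
      simp [hz]
    · by_cases hh : h = 1
      · subst hh
        simp [f, e, hg] at *
        simp [hz]
      · by_cases hgh : g * h = 1
        · simp [f, e, hg, hh, hgh] at *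
          simp [hz]
        · have : c 1 g (g * h) ≠ 0 := by
            rw [Ne, hz]
            simp [hh, Ne.symm hg, Ne.symm hgh]
          simp only [f, e, hg, hh, hgh, if_false, and_false, or_false]
          split_ifs <;> omega
  have hone : ∀ g, f 1 g = 0 := by
    intro g
    have : c 1 1 g = 0 := (hc.1.2.1 _ _ _).2 (by simp)
    simp [f, this]
  have hone' : ∀ g, f g 1 = 0 := by
    intro g
    have : c 1 g g = 0 := (hc.1.2.1 _ _ _).2 (by simp)
    simp [f, this]
  refine ⟨f, ?_, ?_, hone, hone', ?_, ?_, ?_⟩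
  · intro g h
    simp only [f]
    split_ifs <;> simp
  · intro g h
    simp only [f]
    split_ifs <;> simp
  · intro g hg
    simp [f, hg]
  · intro g h k
    have h1 := hf g h
    have h2 := hf (g * h) k
    have h3 := hf h k
    have h4 := hf g (h * k)
    have h5 := hc.1.2.2.1 1 g (g * h) (g * h * k)
    have h6 := hc.1.2.2.2 g 1 h (h * k)
    rw [mul_one] at h6
    simp only [← mul_assoc] at *
    omega
  · intro g h
    have h1 := hf h g
    have h2 := hf (h * g * h⁻¹) h
    have h3 := hc.left_eq_right (h * g * h⁻¹) h
    have h4 : e (h * g * h⁻¹) = e g := by simp [e]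
    rw [inv_mul_cancel_right] at h2 h3
    omega

end BiInvariant

theorem minOb_eq {G : Type*} [Group G] {r : G → ℝ} {P : Set G} (hr : IsRotationData r P) :
    minOb G = {p | p.Prime ∧ ∃ g : G, orderOf g = p} := by
  have hgen : ∀ n : ℕ, n ≠ 0 → ∃ a : Multiplicative (ZMod n), orderOf a = n := fun n hn =>
    have : NeZero n := ⟨hn⟩
    ⟨Multiplicative.ofAdd 1, by rw [orderOf_ofAdd_eq_addOrderOf, ZMod.addOrderOf_one]⟩
  have hprime : ∀ {p : ℕ}, p.Prime → (∃ g : G, orderOf g = p) → p ∈ Ob G := by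
    rintro p hp ⟨g, hg⟩
    obtain ⟨a, ha⟩ := hgen p hp.ne_zero
    exact ⟨hp.two_le, not_circularlyOrderable_prod hp hg ha⟩
  ext n
  constructor
  · rintro ⟨⟨hn, hno⟩, hmin⟩
    have : NeZero n := ⟨by omega⟩
    by_contra hcon
    refine hno (hr.prod (isRotationData_zmod n) fun p hp g a hg ha => hcon ?_).circularlyOrderable
    have hpn : p ∣ n := by
      rw [← ha]
      simpa using orderOf_dvd_natCard a
    rw [← hmin p (hprime hp ⟨g, hg⟩) hpn]
    exact ⟨hp, g, hg⟩
  · rintro ⟨hp, g, hg⟩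
    exact ⟨hprime hp ⟨g, hg⟩, fun m hm hmn =>
      (hp.eq_one_or_self_of_dvd m hmn).resolve_left fun h => by have := hm.1; omega⟩

/-- If `G` and `H` both admit bi-invariant circular orderings, then `G × H` is
circularly-orderable if and only if `min(Ob(G)) ∩ min(Ob(H)) = ∅`. -/
theorem product_of_biInvariant_circularlyOrderable_iff {G H : Type*} [Group G] [Group H]
    (hG : ∃ c : G → G → G → ℤ, IsBiInvariantCircularOrdering c)
    (hH : ∃ c : H → H → H → ℤ, IsBiInvariantCircularOrdering c) :
    CircularlyOrderable (G × H) ↔ minOb G ∩ minOb H = ∅ := by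
  obtain ⟨_, hG⟩ := hG
  obtain ⟨_, hH⟩ := hH
  obtain ⟨r, P, hr⟩ := hG.orderCocycle.exists_isRotationData
  obtain ⟨s, Q, hs⟩ := hH.orderCocycle.exists_isRotationData
  rw [minOb_eq hr, minOb_eq hs, Set.eq_empty_iff_forall_notMem]
  constructor
  · rintro hGH p ⟨⟨hp, g, hg⟩, -, h, hh⟩
    exact not_circularlyOrderable_prod hp hg hh hGH
  · intro hdisj
    exact (hr.prod hs fun p hp g h hg hh =>
      hdisj p ⟨⟨hp, g, hg⟩, hp, h, hh⟩).circularlyOrderable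
end
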